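/- arXiv:2406.15980 — 3 statements merged into one kernel-verified Lean document; each statement's English description precedes it below -/
import Mathlib

section
/- For any natural numbers a_1 ≥ a_2 ≥ … ≥ a_k > 0, the number of ways to play Stanley Solitaire to completion starting from the position [a_1, …, a_k], i.e. S([a_1,…,a_k]), equals ( (a_1 + a_2 + … + a_k)! / ( (a_1+k−1)! · (a_2+k−2)! ⋯ (a_k)! ) ) · ∏_{1 ≤ i < j ≤ k} (a_i − a_j + j − i). -/
/-- Delete all leading and trailing zeros from a list of naturals. -/
def trim (l : List ℕ) : List ℕ :=
  ((l.dropWhile (· == 0)).reverse.dropWhile (· == 0)).reverse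

/-- Apply one legal move of Stanley Solitaire to the position `p`, returning `none` if the
move is illegal.  The move `some i` (for `0 ≤ i < k - 1`, 0-indexed) exchanges the adjacent
piles at positions `i` and `i+1`, which is legal when the left pile is strictly larger, and
eats one candy from the larger pile (now on the right).  The move `none` exchanges the last
pile with the implied empty pile to its right, eating one candy.  In both cases all leading
and trailing zeros are deleted afterwards. -/
def applyMove (p : List ℕ) (m : Option ℕ) : Option (List ℕ) :=
  match m with
  | some i =>
      if i + 1 < p.length ∧ p.getD (i + 1) 0 < p.getD i 0 then
        some (trim ((p.set i (p.getD (i + 1) 0)).set (i + 1) (p.getD i 0 - 1)))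
      else none
  | none =>
      if p = [] then none
      else some (trim (p.dropLast ++ [0, p.getD (p.length - 1) 0 - 1]))

/-- Play the sequence of moves `ms` starting from position `p`, returning the final position,
or `none` if some move along the way is illegal. -/
def run : List ℕ → List (Option ℕ) → Option (List ℕ)
  | p, [] => some p
  | p, m :: ms => (applyMove p m).bind fun q => run q ms

/-- `numPlays p` is the number of ways to play Stanley Solitaire to completion from the
position `p`: the number of finite sequences of legal moves starting at `p` and ending at
the empty position `[]`. -/
noncomputable def numPlays (p : List ℕ) : ℕ :=
  Nat.card {ms : List (Option ℕ) // run p ms = some []}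

open MvPolynomial Finset

/-- The ring automorphism exchanging the variables `X i` and `X (i + 1)`. -/
noncomputable def swapVars (i : ℕ) : MvPolynomial ℕ ℚ ≃ₐ[ℚ] MvPolynomial ℕ ℚ :=
  renameEquiv ℚ (Equiv.swap i (i + 1))

lemma swapVars_X (i j : ℕ) : swapVars i (X j) = X (Equiv.swap i (i + 1) j) := by
  simp [swapVars]

lemma swapVars_X_self (i : ℕ) : swapVars i (X i) = X (i + 1) := by
  simp [swapVars_X]

lemma swapVars_X_succ (i : ℕ) : swapVars i (X (i + 1)) = X i := by
  simp [swapVars_X]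

lemma swapVars_X_of_ne {i j : ℕ} (h : j ≠ i) (h' : j ≠ i + 1) : swapVars i (X j) = X j := by
  rw [swapVars_X, Equiv.swap_apply_of_ne_of_ne h h']

lemma swapVars_swapVars (i : ℕ) (g : MvPolynomial ℕ ℚ) : swapVars i (swapVars i g) = g := by
  simp only [swapVars, renameEquiv_apply, rename_rename]
  rw [← Equiv.coe_trans, Equiv.swap_swap]
  simp

lemma swapVars_comm {i j : ℕ} (h : i + 2 ≤ j) (g : MvPolynomial ℕ ℚ) :
    swapVars i (swapVars j g) = swapVars j (swapVars i g) := by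
  simp only [swapVars, renameEquiv_apply, rename_rename]
  congr 2
  funext k
  simp only [Function.comp_apply, Equiv.swap_apply_def]
  split_ifs <;> omega

lemma swapVars_braid (i : ℕ) (g : MvPolynomial ℕ ℚ) :
    swapVars i (swapVars (i + 1) (swapVars i g)) =
      swapVars (i + 1) (swapVars i (swapVars (i + 1) g)) := by
  simp only [swapVars, renameEquiv_apply, rename_rename]
  congr 2
  funext k
  simp only [Function.comp_apply, Equiv.swap_apply_def]
  split_ifs <;> omega

lemma X_sub_X_ne_zero {i j : ℕ} (h : i ≠ j) : (X i - X j : MvPolynomial ℕ ℚ) ≠ 0 :=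
  sub_ne_zero.2 fun H => h (X_injective H)

lemma X_sub_X_dvd_sub_swapVars (i : ℕ) (g : MvPolynomial ℕ ℚ) :
    X i - X (i + 1) ∣ g - swapVars i g := by
  rw [← Ideal.mem_span_singleton, ← Ideal.Quotient.mk_eq_mk_iff_sub_mem]
  set I := Ideal.span {(X i - X (i + 1) : MvPolynomial ℕ ℚ)}
  have hI : Ideal.Quotient.mk I (X i) = Ideal.Quotient.mk I (X (i + 1)) :=
    Ideal.Quotient.mk_eq_mk_iff_sub_mem _ _ |>.2 (Ideal.subset_span rfl)
  have : Ideal.Quotient.mkₐ ℚ I = (Ideal.Quotient.mkₐ ℚ I).comp (swapVars i).toAlgHom := by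
    ext j
    by_cases h : j = i
    · subst h; simpa [swapVars_X_self] using hI
    by_cases h' : j = i + 1
    · subst h'; simpa [swapVars_X_succ] using hI.symm
    simp [swapVars_X_of_ne h h']
  exact DFunLike.congr_fun this g

/-- The Newton divided difference `(g - sᵢ g) / (xᵢ - xᵢ₊₁)`. -/
noncomputable def divDiff (i : ℕ) : MvPolynomial ℕ ℚ →ₗ[ℚ] MvPolynomial ℕ ℚ where
  toFun g := (X_sub_X_dvd_sub_swapVars i g).choose
  map_add' g h := by
    apply mul_left_cancel₀ (X_sub_X_ne_zero (Nat.succ_ne_self i).symm)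
    rw [mul_add, ← (X_sub_X_dvd_sub_swapVars i (g + h)).choose_spec,
      ← (X_sub_X_dvd_sub_swapVars i g).choose_spec, ← (X_sub_X_dvd_sub_swapVars i h).choose_spec,
      map_add]
    ring
  map_smul' c g := by
    apply mul_left_cancel₀ (X_sub_X_ne_zero (Nat.succ_ne_self i).symm)
    rw [RingHom.id_apply, mul_smul_comm, ← (X_sub_X_dvd_sub_swapVars i (c • g)).choose_spec,
      ← (X_sub_X_dvd_sub_swapVars i g).choose_spec, map_smul, smul_sub]

lemma X_sub_X_mul_divDiff (i : ℕ) (g : MvPolynomial ℕ ℚ) :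
    (X i - X (i + 1)) * divDiff i g = g - swapVars i g :=
  (X_sub_X_dvd_sub_swapVars i g).choose_spec.symm

lemma divDiff_eq_iff {i : ℕ} {g h : MvPolynomial ℕ ℚ} :
    divDiff i g = h ↔ g - swapVars i g = (X i - X (i + 1)) * h := by
  rw [← X_sub_X_mul_divDiff]
  exact (mul_right_inj' (X_sub_X_ne_zero (Nat.succ_ne_self i).symm)).symm

lemma swapVars_divDiff (i : ℕ) (g : MvPolynomial ℕ ℚ) :
    swapVars i (divDiff i g) = divDiff i g := by
  have h := congrArg (swapVars i) (X_sub_X_mul_divDiff i g)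
  simp only [map_mul, map_sub, swapVars_X_self, swapVars_X_succ, swapVars_swapVars] at h
  apply mul_left_cancel₀ (X_sub_X_ne_zero (Nat.succ_ne_self i).symm)
  linear_combination -h - X_sub_X_mul_divDiff i g

lemma divDiff_divDiff (i : ℕ) (g : MvPolynomial ℕ ℚ) : divDiff i (divDiff i g) = 0 := by
  rw [divDiff_eq_iff, swapVars_divDiff]
  ring

lemma divDiff_comm {i j : ℕ} (hij : i + 2 ≤ j) (g : MvPolynomial ℕ ℚ) :
    divDiff i (divDiff j g) = divDiff j (divDiff i g) := by
  have hi := X_sub_X_ne_zero (Nat.succ_ne_self i).symm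
  have hj := X_sub_X_ne_zero (Nat.succ_ne_self j).symm
  have h1 := X_sub_X_mul_divDiff i (divDiff j g)
  have h2 := X_sub_X_mul_divDiff j (divDiff i g)
  have h3 := X_sub_X_mul_divDiff i g
  have h4 := X_sub_X_mul_divDiff j g
  have h5 := congrArg (swapVars i) h4
  have h6 := congrArg (swapVars j) h3
  simp only [map_mul, map_sub] at h5 h6
  rw [swapVars_X_of_ne (by omega) (by omega), swapVars_X_of_ne (by omega) (by omega),
    swapVars_comm hij] at h5
  rw [swapVars_X_of_ne (by omega) (by omega), swapVars_X_of_ne (by omega) (by omega)] at h6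
  apply mul_left_cancel₀ (mul_ne_zero hi hj)
  linear_combination (X j - X (j + 1)) * h1 - (X i - X (i + 1)) * h2 - h3 + h4 - h5 + h6

/-- Both sides of the braid relation, cleared of denominators, are the alternating sum over the
permutations of three consecutive variables. -/
lemma divDiff_braid (i : ℕ) (g : MvPolynomial ℕ ℚ) :
    divDiff i (divDiff (i + 1) (divDiff i g)) =
      divDiff (i + 1) (divDiff i (divDiff (i + 1) g)) := by
  have hx : swapVars i (X (i + 2)) = X (i + 2) := swapVars_X_of_ne (by omega) (by omega)
  have hy : swapVars (i + 1) (X i) = X i := swapVars_X_of_ne (by omega) (by omega)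
  have e1 := swapVars_X_self i
  have e2 := swapVars_X_succ i
  have e3 := swapVars_X_self (i + 1)
  have e4 := swapVars_X_succ (i + 1)
  have a1 := X_sub_X_mul_divDiff i g
  have a2 := X_sub_X_mul_divDiff (i + 1) (divDiff i g)
  have a3 := X_sub_X_mul_divDiff i (divDiff (i + 1) (divDiff i g))
  have a4 := congrArg (swapVars i) a2
  have a5 := congrArg (swapVars (i + 1)) a1
  have a6 := congrArg (swapVars i) a5
  have b1 := X_sub_X_mul_divDiff (i + 1) g
  have b2 := X_sub_X_mul_divDiff i (divDiff (i + 1) g)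
  have b3 := X_sub_X_mul_divDiff (i + 1) (divDiff i (divDiff (i + 1) g))
  have b4 := congrArg (swapVars (i + 1)) b2
  have b5 := congrArg (swapVars i) b1
  have b6 := congrArg (swapVars (i + 1)) b5
  simp only [add_assoc, Nat.reduceAdd] at *
  simp only [map_mul, map_sub, e1, e2, e3, e4, hx, hy, swapVars_divDiff] at a4 a5 a6 b4 b5 b6
  rw [swapVars_braid] at a6
  apply mul_left_cancel₀ (mul_ne_zero (mul_ne_zero (X_sub_X_ne_zero (i := i) (j := i + 1) (by omega))
    (X_sub_X_ne_zero (i := i + 1) (j := i + 2) (by omega)))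
    (X_sub_X_ne_zero (i := i) (j := i + 2) (by omega)))
  linear_combination (X (i + 1) - X (i + 2)) * (X i - X (i + 2)) * a3
    + (X i - X (i + 2)) * a2 - (X (i + 1) - X (i + 2)) * a4 + a1 - a5 + a6
    - (X i - X (i + 1)) * (X i - X (i + 2)) * b3
    - (X i - X (i + 2)) * b2 + (X i - X (i + 1)) * b4 - b1 + b5 - b6


/-- The monomial with exponents `e`, except that `X i` and `X (i + 1)` get exponents `a`, `b`. -/
noncomputable def monomialUpdate (i : ℕ) (e : ℕ →₀ ℕ) (a b : ℕ) : MvPolynomial ℕ ℚ :=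
  monomial ((e.update i a).update (i + 1) b) 1

lemma update_update_apply (i : ℕ) (e : ℕ →₀ ℕ) (a b j : ℕ) :
    (e.update i a).update (i + 1) b j = if j = i then a else if j = i + 1 then b else e j := by
  simp only [Finsupp.coe_update, Function.update_apply]
  split_ifs <;> omega

lemma monomialUpdate_self (i : ℕ) (e : ℕ →₀ ℕ) :
    monomialUpdate i e (e i) (e (i + 1)) = monomial e 1 := by
  simp [monomialUpdate]

lemma swapVars_monomialUpdate (i : ℕ) (e : ℕ →₀ ℕ) (a b : ℕ) :
    swapVars i (monomialUpdate i e a b) = monomialUpdate i e b a := by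
  simp only [monomialUpdate, swapVars, renameEquiv_apply, rename_monomial]
  refine congrArg (monomial · (1 : ℚ)) (Finsupp.ext fun j => ?_)
  rw [Finsupp.mapDomain_equiv_apply, update_update_apply, update_update_apply, Equiv.symm_swap,
    Equiv.swap_apply_def]
  split_ifs <;> omega

lemma X_mul_monomialUpdate (i : ℕ) (e : ℕ →₀ ℕ) (a b : ℕ) :
    X i * monomialUpdate i e a b = monomialUpdate i e (a + 1) b := by
  simp only [monomialUpdate, X, monomial_mul, one_mul]
  refine congrArg (monomial · (1 : ℚ)) (Finsupp.ext fun j => ?_)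
  rw [Finsupp.add_apply, update_update_apply, update_update_apply, Finsupp.single_apply]
  split_ifs <;> omega

lemma X_succ_mul_monomialUpdate (i : ℕ) (e : ℕ →₀ ℕ) (a b : ℕ) :
    X (i + 1) * monomialUpdate i e a b = monomialUpdate i e a (b + 1) := by
  simp only [monomialUpdate, X, monomial_mul, one_mul]
  refine congrArg (monomial · (1 : ℚ)) (Finsupp.ext fun j => ?_)
  rw [Finsupp.add_apply, update_update_apply, update_update_apply, Finsupp.single_apply]
  split_ifs <;> omega

lemma divDiff_monomialUpdate_self (i : ℕ) (e : ℕ →₀ ℕ) (a : ℕ) :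
    divDiff i (monomialUpdate i e a a) = 0 := by
  rw [divDiff_eq_iff, swapVars_monomialUpdate, sub_self, mul_zero]

lemma divDiff_monomialUpdate_swap (i : ℕ) (e : ℕ →₀ ℕ) (a b : ℕ) :
    divDiff i (monomialUpdate i e a b) = -divDiff i (monomialUpdate i e b a) := by
  rw [divDiff_eq_iff, mul_neg, X_sub_X_mul_divDiff, swapVars_monomialUpdate,
    swapVars_monomialUpdate, neg_sub]

lemma divDiff_monomialUpdate_succ (i : ℕ) (e : ℕ →₀ ℕ) (a : ℕ) :
    divDiff i (monomialUpdate i e (a + 1) a) = monomialUpdate i e a a := by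
  rw [divDiff_eq_iff, swapVars_monomialUpdate, sub_mul, X_mul_monomialUpdate,
    X_succ_mul_monomialUpdate]

lemma divDiff_monomialUpdate_step (i : ℕ) (e : ℕ →₀ ℕ) (a b : ℕ) :
    divDiff i (monomialUpdate i e (a + 1) b) = divDiff i (monomialUpdate i e a (b + 1)) +
      monomialUpdate i e a b + monomialUpdate i e b a := by
  rw [divDiff_eq_iff, mul_add, mul_add, X_sub_X_mul_divDiff]
  simp only [swapVars_monomialUpdate, sub_mul, X_mul_monomialUpdate, X_succ_mul_monomialUpdate]
  ring

/-- Induction scheme matching the recursion for divided differences of monomials. -/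
lemma pair_induction {P : ℕ → ℕ → Prop} (symm : ∀ a b, P a b → P b a) (diag : ∀ a, P a a)
    (succ : ∀ a, P (a + 1) a) (step : ∀ a b, b < a → P a (b + 1) → P (a + 1) b) (a b : ℕ) :
    P a b := by
  have key : ∀ d b, P (b + d) b := by
    intro d
    induction d using Nat.strong_induction_on with
    | _ d ih =>
      intro b
      match d with
      | 0 => exact diag b
      | 1 => exact succ b
      | d + 2 =>
        refine step (b + (d + 1)) b (by omega) ?_
        have := ih d (by omega) (b + 1)
        rwa [show b + 1 + d = b + (d + 1) by omega] at this
  rcases le_total a b with h | h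
  · exact symm _ _ (by simpa [Nat.add_sub_cancel' h] using key (b - a) a)
  · simpa [Nat.add_sub_cancel' h] using key (a - b) b

/-- Polynomials of degree `d` whose exponent vectors lie under the staircase `(m, m - 1, …, 0)`. -/
noncomputable def staircase (m d : ℕ) : Submodule ℚ (MvPolynomial ℕ ℚ) :=
  Submodule.span ℚ {g | ∃ e : ℕ →₀ ℕ, (∀ j, e j ≤ m - j) ∧ ∑ j ∈ range (m + 1), e j = d ∧
    g = monomial e 1}

lemma sum_range_update {m i : ℕ} (hi : i < m) (e : ℕ →₀ ℕ) (a b : ℕ) :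
    ∑ j ∈ range (m + 1), (e.update i a).update (i + 1) b j + e i + e (i + 1) =
      ∑ j ∈ range (m + 1), e j + a + b := by
  have key : ∀ c, ∀ k < m + 1, (∑ j ∈ range (m + 1), if j = k then c else 0) = c := by
    intro c k hk
    simp [hk]
  have h : ∑ j ∈ range (m + 1), ((e.update i a).update (i + 1) b j +
      (if j = i then e i else 0) + (if j = i + 1 then e (i + 1) else 0)) =
      ∑ j ∈ range (m + 1), (e j + (if j = i then a else 0) + (if j = i + 1 then b else 0)) := by
    refine sum_congr rfl fun j _ => ?_
    rw [update_update_apply]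
    split_ifs <;> first | omega | (subst_vars; omega)
  simp only [sum_add_distrib] at h
  rwa [key _ i (by omega), key _ (i + 1) (by omega), key _ i (by omega),
    key _ (i + 1) (by omega)] at h

lemma monomialUpdate_mem_staircase {m d i : ℕ} (hi : i < m) {e : ℕ →₀ ℕ} (he : ∀ j, e j ≤ m - j)
    {a b : ℕ} (ha : a ≤ m - i) (hb : b ≤ m - (i + 1))
    (hd : ∑ j ∈ range (m + 1), e j + a + b = d + e i + e (i + 1)) :
    monomialUpdate i e a b ∈ staircase m d := by
  refine Submodule.subset_span ⟨_, fun j => ?_, ?_, rfl⟩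
  · rw [update_update_apply]
    split_ifs with h h'
    · rwa [h]
    · rwa [h']
    · exact he j
  · have := sum_range_update hi e a b
    omega

lemma divDiff_mem_staircase {m d i : ℕ} (hi : i < m) {g : MvPolynomial ℕ ℚ}
    (hg : g ∈ staircase m (d + 1)) : divDiff i g ∈ staircase m d := by
  induction hg using Submodule.span_induction with
  | zero => simp
  | add x y _ _ hx hy => rw [map_add]; exact add_mem hx hy
  | smul c x _ hx => rw [map_smul]; exact Submodule.smul_mem _ _ hx
  | mem x hx =>
    obtain ⟨e, he, hd, rfl⟩ := hx
    have key : ∀ a b, a ≤ m - i → b ≤ m - i →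
        ∑ j ∈ range (m + 1), e j + a + b = d + 1 + e i + e (i + 1) →
        divDiff i (monomialUpdate i e a b) ∈ staircase m d := by
      refine pair_induction ?_ ?_ ?_ ?_
      · intro a b h ha hb hd
        rw [divDiff_monomialUpdate_swap]
        exact neg_mem (h hb ha (by omega))
      · intro a _ _ _
        rw [divDiff_monomialUpdate_self]
        exact zero_mem _
      · intro a _ _ _
        rw [divDiff_monomialUpdate_succ]
        exact monomialUpdate_mem_staircase hi he (by omega) (by omega) (by omega)
      · intro a b hab h _ _ _
        rw [divDiff_monomialUpdate_step]
        exact add_mem (add_mem (h (by omega) (by omega) (by omega))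
          (monomialUpdate_mem_staircase hi he (by omega) (by omega) (by omega)))
          (monomialUpdate_mem_staircase hi he (by omega) (by omega) (by omega))
    have h1 := he (i + 1)
    simpa only [monomialUpdate_self] using key (e i) (e (i + 1)) (he i) (by omega) (by omega)

/-- The determinantal weight attached to the beta numbers `l 0, …, l (N - 1)`. -/
noncomputable def betaWeight (N : ℕ) (l : ℕ → ℕ) : ℚ :=
  (∏ j ∈ range N, ∏ i ∈ range j, ((l i : ℚ) - l j)) / ∏ j ∈ range N, ((l j).factorial : ℚ)

lemma prod_prod_Ioi (N : ℕ) (f : ℕ → ℕ → ℚ) :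
    ∏ i : Fin N, ∏ j ∈ Ioi i, f i j = ∏ j ∈ range N, ∏ i ∈ range j, f i j := by
  rw [prod_comm' (t' := univ) (s' := fun j => Iio j) (by simp)]
  rw [← Fin.prod_univ_eq_prod_range (fun j => ∏ i ∈ range j, f i j)]
  refine prod_congr rfl fun j _ => ?_
  rw [← Nat.Iio_eq_range, ← Fin.map_valEmbedding_Iio, prod_map]
  rfl

lemma prod_sub_eq_det (N : ℕ) :
    ∃ c : ℚ, ∀ v : ℕ → ℚ, ∏ j ∈ range N, ∏ i ∈ range j, (v i - v j) =
      c * (Matrix.vandermonde fun i : Fin N => v i).det := by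
  refine ⟨∏ j ∈ range N, ∏ i ∈ range j, -1, fun v => ?_⟩
  rw [Matrix.det_vandermonde, prod_prod_Ioi N fun i j => v j - v i, ← prod_mul_distrib]
  refine prod_congr rfl fun j _ => ?_
  rw [← prod_mul_distrib]
  exact prod_congr rfl fun i _ => by ring

lemma betaWeight_swap {N i : ℕ} (hi : i + 1 < N) (l : ℕ → ℕ) :
    betaWeight N (fun j => l (Equiv.swap i (i + 1) j)) = -betaWeight N l := by
  obtain ⟨c, hc⟩ := prod_sub_eq_det N
  set σ : Equiv.Perm (Fin N) := Equiv.swap ⟨i, by omega⟩ ⟨i + 1, hi⟩ with hσ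
  have hval : ∀ j : Fin N, Equiv.swap i (i + 1) (j : ℕ) = σ j := by
    intro j
    simp only [hσ, Equiv.swap_apply_def, Fin.ext_iff]
    split_ifs <;> rfl
  have hden : ∏ j ∈ range N, ((l (Equiv.swap i (i + 1) j)).factorial : ℚ) =
      ∏ j ∈ range N, ((l j).factorial : ℚ) := by
    rw [← Fin.prod_univ_eq_prod_range (fun j => ((l (Equiv.swap i (i + 1) j)).factorial : ℚ)),
      ← Fin.prod_univ_eq_prod_range (fun j => ((l j).factorial : ℚ))]
    simp only [hval]
    exact Equiv.prod_comp σ fun j : Fin N => ((l j).factorial : ℚ)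
  have hne : (⟨i, by omega⟩ : Fin N) ≠ ⟨i + 1, hi⟩ := by simp
  have hdet : (Matrix.vandermonde fun j : Fin N => (l (Equiv.swap i (i + 1) (j : ℕ)) : ℚ)).det =
      -(Matrix.vandermonde fun j : Fin N => (l j : ℚ)).det := by
    have := Matrix.det_permute σ (Matrix.vandermonde fun j : Fin N => (l j : ℚ))
    rw [hσ, Equiv.Perm.sign_swap hne, ← hσ] at this
    simp only [hval]
    exact this.trans (by simp)
  rw [betaWeight, betaWeight, hden, hc fun j => (l (Equiv.swap i (i + 1) j) : ℚ),
    hc fun j => (l j : ℚ), hdet]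
  ring

lemma det_updateRow_sum {N : ℕ} (M : Matrix (Fin N) (Fin N) ℚ) (x c : Fin N → ℚ) :
    ∑ i, (M.updateRow i fun j => M i j * (x i - c j)).det = (∑ i, x i - ∑ j, c j) * M.det := by
  have key : ∀ i, ∀ σ : Equiv.Perm (Fin N),
      ∏ k, (M.updateRow i fun j => M i j * (x i - c j)) (σ k) k =
        (x i - c (σ.symm i)) * ∏ k, M (σ k) k := by
    intro i σ
    rw [← mul_prod_erase univ _ (mem_univ (σ.symm i)),
      ← mul_prod_erase univ (fun k => M (σ k) k) (mem_univ (σ.symm i))]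
    rw [prod_congr rfl (g := fun k => M (σ k) k)]
    · simp; ring
    · intro k hk
      have : σ k ≠ i := fun h => (mem_erase.1 hk).1 (by rw [← h, Equiv.symm_apply_apply])
      rw [Matrix.updateRow_ne this]
  simp only [Matrix.det_apply', key]
  rw [sum_comm, mul_sum]
  refine sum_congr rfl fun σ _ => ?_
  rw [← mul_sum, ← sum_mul, sum_sub_distrib, Equiv.sum_comp σ.symm c]
  ring

lemma sum_mul_prod_sub (N : ℕ) (l : ℕ → ℚ) :
    ∑ k ∈ range N, l k * ∏ j ∈ range N, ∏ i ∈ range j,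
        (Function.update l k (l k - 1) i - Function.update l k (l k - 1) j) =
      (∑ k ∈ range N, l k - ∑ k ∈ range N, (k : ℚ)) *
        ∏ j ∈ range N, ∏ i ∈ range j, (l i - l j) := by
  obtain ⟨c, hc⟩ := prod_sub_eq_det N
  set M : (Fin N → ℚ) → Matrix (Fin N) (Fin N) ℚ :=
    fun v => Matrix.of fun i j => (descPochhammer ℚ j).eval (v i) with hM
  have hdet : ∀ v : Fin N → ℚ, (Matrix.vandermonde v).det = (M v).det := fun v =>
    Matrix.det_eval_matrixOfPolynomials_eq_det_vandermonde v _
      (fun i => descPochhammer_natDegree ℚ i) (fun i => monic_descPochhammer ℚ i)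
  simp only [hc, hdet]
  rw [← Fin.sum_univ_eq_sum_range (fun k => l k * (c * (M fun i : Fin N =>
    Function.update l k (l k - 1) i).det)), ← Fin.sum_univ_eq_sum_range l,
    ← Fin.sum_univ_eq_sum_range (fun k => (k : ℚ)), mul_left_comm,
    ← det_updateRow_sum (M fun i => l i) (fun i => l i) (fun j => j), mul_sum]
  refine sum_congr rfl fun k _ => ?_
  rw [mul_left_comm]
  congr 1
  have hrow : (M fun i : Fin N => Function.update l k (l k - 1) i) =
      (M fun i => l i).updateRow k fun j => (descPochhammer ℚ j).eval (l k - 1) := by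
    ext i j
    by_cases h : i = k
    · subst h; simp [hM]
    · rw [Matrix.updateRow_ne h]
      simp [hM, Fin.val_ne_of_ne h]
  rw [hrow, ← Matrix.det_updateRow_smul]
  congr 2
  ext j
  have h1 := congrArg (Polynomial.eval (l k)) (descPochhammer_succ_left ℚ j)
  have h2 := congrArg (Polynomial.eval (l k)) (descPochhammer_succ_right ℚ j)
  simp at h1 h2
  simp [hM]
  rw [← h1, h2]

/-- The linear functional sending the monomial `x ^ e` to the weight of the beta numbers of `e`. -/
noncomputable def weightMap (m : ℕ) : MvPolynomial ℕ ℚ →ₗ[ℚ] ℚ :=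
  (basisMonomials ℕ ℚ).constr ℚ fun e => betaWeight (m + 1) fun j => e j + (m - j)

lemma weightMap_monomial (m : ℕ) (e : ℕ →₀ ℕ) :
    weightMap m (monomial e 1) = betaWeight (m + 1) fun j => e j + (m - j) := by
  exact (congrArg (weightMap m) (by simp)).trans ((basisMonomials ℕ ℚ).constr_basis ℚ _ e)

lemma weightMap_divDiff_monomialUpdate {m i : ℕ} (hi : i < m) (e : ℕ →₀ ℕ) (a b : ℕ) :
    weightMap m (divDiff i (monomialUpdate i e a b)) =
      betaWeight (m + 1) fun j => if j = i then a + (m - (i + 1)) else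
        if j = i + 1 then b + (m - (i + 1)) else e j + (m - j) := by
  set w : ℕ → ℕ → ℚ := fun L M => betaWeight (m + 1) fun j => if j = i then L else
    if j = i + 1 then M else e j + (m - j) with hw
  have anti : ∀ L M, w L M = -w M L := by
    intro L M
    simp only [hw]
    rw [← betaWeight_swap (show i + 1 < m + 1 by omega)]
    congr 1
    funext j
    simp only [Equiv.swap_apply_def]
    split_ifs <;> omega
  have diag : ∀ L, w L L = 0 := fun L => by linarith [anti L L]
  have mono : ∀ a b, weightMap m (monomialUpdate i e a b) =
      w (a + (m - (i + 1)) + 1) (b + (m - (i + 1))) := by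
    intro a b
    rw [monomialUpdate, weightMap_monomial]
    simp only [hw]
    congr 1
    funext j
    rw [update_update_apply]
    split_ifs with h h'
    · omega
    · rw [h']
    · rfl
  change _ = w (a + (m - (i + 1))) (b + (m - (i + 1)))
  induction a, b using pair_induction with
  | symm a b h => rw [divDiff_monomialUpdate_swap, map_neg, h, anti, neg_neg]
  | diag a => rw [divDiff_monomialUpdate_self, map_zero, diag]
  | succ a => rw [divDiff_monomialUpdate_succ, mono, add_right_comm]
  | step a b hab h =>
    rw [divDiff_monomialUpdate_step, map_add, map_add, h, mono, mono,
      anti (b + (m - (i + 1)) + 1), add_right_comm a, add_right_comm b]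
    ring

lemma betaWeight_update (N k : ℕ) (hk : k < N) (l : ℕ → ℕ) (hl : 0 < l k) :
    betaWeight N (Function.update l k (l k - 1)) =
      (l k * ∏ j ∈ range N, ∏ i ∈ range j,
        (Function.update (fun i => (l i : ℚ)) k (l k - 1) i -
          Function.update (fun i => (l i : ℚ)) k (l k - 1) j)) /
        ∏ j ∈ range N, ((l j).factorial : ℚ) := by
  have hcast : ∀ i, ((Function.update l k (l k - 1) i : ℕ) : ℚ) =
      Function.update (fun i => (l i : ℚ)) k (l k - 1) i := by
    intro i
    by_cases h : i = k
    · subst h; simp [Nat.cast_sub (Nat.one_le_iff_ne_zero.2 hl.ne')]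
    · simp [h]
  have hden : ∏ j ∈ range N, ((l j).factorial : ℚ) =
      l k * ∏ j ∈ range N, ((Function.update l k (l k - 1) j).factorial : ℚ) := by
    rw [← mul_prod_erase (range N) _ (mem_range.2 hk),
      ← mul_prod_erase (range N) (fun j => ((Function.update l k (l k - 1) j).factorial : ℚ))
        (mem_range.2 hk), ← mul_assoc]
    congr 1
    · rw [Function.update_self, ← Nat.cast_mul, Nat.mul_factorial_pred hl.ne']
    · exact prod_congr rfl fun j hj => by rw [Function.update_of_ne (ne_of_mem_erase hj)]
  have hl' : (l k : ℚ) ≠ 0 := by exact_mod_cast hl.ne'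
  simp only [betaWeight, hcast]
  rw [hden, mul_div_mul_left _ _ hl']

lemma sum_weightMap_divDiff {m d : ℕ} {g : MvPolynomial ℕ ℚ} (hg : g ∈ staircase m (d + 1)) :
    ∑ i ∈ range m, weightMap m (divDiff i g) = (d + 1) * weightMap m g := by
  induction hg using Submodule.span_induction with
  | zero => simp
  | add x y _ _ hx hy => simp only [map_add, sum_add_distrib, hx, hy, mul_add]
  | smul c x _ hx =>
    simp only [map_smul, smul_eq_mul, ← mul_sum, hx]
    ring
  | mem x hx =>
    obtain ⟨e, he, hd, rfl⟩ := hx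
    set l : ℕ → ℕ := fun j => e j + (m - j) with hl
    have hlm : l m = 0 := by
      have := he m
      simp only [hl]
      omega
    have hterm : ∀ i ∈ range m, weightMap m (divDiff i (monomial e 1)) =
        betaWeight (m + 1) (Function.update l i (l i - 1)) := by
      intro i hi
      rw [mem_range] at hi
      rw [← monomialUpdate_self i e, weightMap_divDiff_monomialUpdate hi]
      congr 1
      funext j
      simp only [hl, Function.update_apply]
      split_ifs with h h'
      · omega
      · rw [h']
      · rfl
    rw [sum_congr rfl hterm, weightMap_monomial,
      sum_congr rfl fun i hi => betaWeight_update (m + 1) i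
        (by have := mem_range.1 hi; omega) l (by have := mem_range.1 hi; simp only [hl]; omega),
      ← sum_div]
    have h := sum_mul_prod_sub (m + 1) fun i => (l i : ℚ)
    rw [sum_range_succ, hlm, Nat.cast_zero, zero_mul, add_zero] at h
    rw [h, betaWeight, mul_div_assoc]
    congr 1
    have h1 : ∑ k ∈ range (m + 1), l k = (d + 1) + ∑ k ∈ range (m + 1), k := by
      rw [← hd, ← sum_range_reflect (fun k => k), ← sum_add_distrib]
      exact sum_congr rfl fun k _ => by simp only [hl]; omega
    have h2 := congrArg (Nat.cast : ℕ → ℚ) h1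
    push_cast at h2
    rw [h2]
    ring

lemma betaWeight_succ (N : ℕ) (a : ℕ → ℕ) (ha : a N = 0) :
    betaWeight (N + 1) (fun j => a j + (N - j)) = betaWeight N fun j => a j + (N - 1 - j) := by
  have hnum : ∏ i ∈ range N, (((a i + (N - i) : ℕ) : ℚ) - (a N + (N - N) : ℕ)) =
      ∏ i ∈ range N, ((a i + (N - i) : ℕ) : ℚ) :=
    prod_congr rfl fun i _ => by simp [ha]
  have hden : ∏ j ∈ range N, ((a j + (N - j)).factorial : ℚ) =
      (∏ j ∈ range N, ((a j + (N - j) : ℕ) : ℚ)) *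
        ∏ j ∈ range N, ((a j + (N - 1 - j)).factorial : ℚ) := by
    rw [← prod_mul_distrib]
    refine prod_congr rfl fun j hj => ?_
    have := mem_range.1 hj
    rw [show a j + (N - j) = a j + (N - 1 - j) + 1 by omega, Nat.factorial_succ, Nat.cast_mul]
  have hne : ∏ j ∈ range N, ((a j + (N - j) : ℕ) : ℚ) ≠ 0 := by
    refine prod_ne_zero_iff.2 fun j hj => ?_
    have := mem_range.1 hj
    exact_mod_cast (by omega : a j + (N - j) ≠ 0)
  have hV : ∏ j ∈ range N, ∏ i ∈ range j, (((a i + (N - i) : ℕ) : ℚ) - (a j + (N - j) : ℕ)) =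
      ∏ j ∈ range N, ∏ i ∈ range j,
        (((a i + (N - 1 - i) : ℕ) : ℚ) - (a j + (N - 1 - j) : ℕ)) := by
    refine prod_congr rfl fun j hj => prod_congr rfl fun i hi => ?_
    have hj := mem_range.1 hj
    have hi := mem_range.1 hi
    rw [show N - i = N - 1 - i + 1 by omega, show N - j = N - 1 - j + 1 by omega]
    push_cast
    ring
  rw [betaWeight, betaWeight, prod_range_succ, prod_range_succ, hnum, hV, hden]
  simp only [ha, Nat.sub_self, add_zero, Nat.factorial_zero, Nat.cast_one, mul_one]
  rw [mul_comm, mul_div_mul_left _ _ hne]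

lemma betaWeight_eq_of_le {k N : ℕ} (hkN : k ≤ N) (a : ℕ → ℕ) (ha : ∀ j, k ≤ j → a j = 0) :
    betaWeight N (fun j => a j + (N - 1 - j)) = betaWeight k fun j => a j + (k - 1 - j) := by
  induction N, hkN using Nat.le_induction with
  | base => rfl
  | succ N hN ih => rw [← ih, Nat.add_sub_cancel, betaWeight_succ N a (ha N hN)]

/-- The code obtained from `a` by exchanging the entries in places `i`, `i + 1`, at an ascent. -/
def raise (i : ℕ) (a : ℕ → ℕ) (j : ℕ) : ℕ :=
  if j = i then a (i + 1) + 1 else if j = i + 1 then a i else a j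

/-- The code obtained from `a` by exchanging the entries in places `i`, `i + 1`, at a descent. -/
def lower (i : ℕ) (a : ℕ → ℕ) (j : ℕ) : ℕ :=
  if j = i then a (i + 1) else if j = i + 1 then a i - 1 else a j

lemma raise_lower {i : ℕ} {a : ℕ → ℕ} (h : a (i + 1) < a i) : raise i (lower i a) = a := by
  funext j
  simp only [raise, lower]
  split_ifs <;> first | omega | (subst_vars; omega)

lemma raise_le {m i : ℕ} (hi : i < m) {a : ℕ → ℕ} (ha : ∀ j, a j ≤ m - j)
    (h : a i ≤ a (i + 1)) (j : ℕ) : raise i a j ≤ m - j := by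
  have := ha (i + 1)
  have := ha j
  simp only [raise]
  split_ifs <;> omega

lemma lower_le {m i : ℕ} {a : ℕ → ℕ} (ha : ∀ j, a j ≤ m - j) (h : a (i + 1) < a i) (j : ℕ) :
    lower i a j ≤ m - j := by
  have := ha i
  have := ha j
  simp only [lower]
  split_ifs <;> omega

lemma sum_raise {m i : ℕ} (hi : i < m) (a : ℕ → ℕ) :
    ∑ j ∈ range (m + 1), raise i a j = ∑ j ∈ range (m + 1), a j + 1 := by
  have key : ∀ c, ∀ k < m + 1, (∑ j ∈ range (m + 1), if j = k then c else 0) = c := by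
    intro c k hk
    simp [hk]
  have h : ∑ j ∈ range (m + 1), (raise i a j +
      (if j = i then a i else 0) + (if j = i + 1 then a (i + 1) else 0)) =
      ∑ j ∈ range (m + 1), (a j + (if j = i then a (i + 1) + 1 else 0) +
        (if j = i + 1 then a i else 0)) := by
    refine sum_congr rfl fun j _ => ?_
    simp only [raise]
    split_ifs <;> first | omega | (subst_vars; omega)
  simp only [sum_add_distrib] at h
  rw [key _ i (by omega), key _ (i + 1) (by omega), key _ i (by omega),
    key _ (i + 1) (by omega)] at h
  omega

lemma sum_lower {m i : ℕ} (hi : i < m) {a : ℕ → ℕ} (h : a (i + 1) < a i) :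
    ∑ j ∈ range (m + 1), lower i a j + 1 = ∑ j ∈ range (m + 1), a j := by
  rw [← sum_raise hi, raise_lower h]

lemma raise_comm {i j : ℕ} (h : i + 2 ≤ j) (a : ℕ → ℕ) :
    raise i (raise j a) = raise j (raise i a) := by
  funext k
  simp only [raise]
  split_ifs <;> omega

lemma raise_braid (i : ℕ) (a : ℕ → ℕ) :
    raise i (raise (i + 1) (raise i a)) = raise (i + 1) (raise i (raise (i + 1) a)) := by
  funext k
  simp only [raise]
  split_ifs <;> omega

/-- The monomial with exponents `a 0, …, a (m - 1)`. -/
noncomputable def codeMonomial (m : ℕ) (a : ℕ → ℕ) : MvPolynomial ℕ ℚ :=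
  monomial (Finsupp.indicator (range m) fun j _ => a j) 1

lemma indicator_apply_of_le {m : ℕ} {a : ℕ → ℕ} (ha : ∀ j, a j ≤ m - j) (j : ℕ) :
    Finsupp.indicator (range m) (fun j _ => a j) j = a j := by
  have := ha j
  rw [Finsupp.indicator_apply]
  split_ifs with h
  · rfl
  · rw [mem_range] at h
    omega

open Classical in
/-- The Schubert polynomial of the permutation with code `a` under the staircase
`(m, m - 1, …, 0)`, where `k` is the number of divided differences to apply, which is the size of
the staircase minus the size of `a`. -/
noncomputable def schubert (m : ℕ) : ℕ → (ℕ → ℕ) → MvPolynomial ℕ ℚ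
  | 0, _ => codeMonomial m fun j => m - j
  | k + 1, a =>
    if h : ∃ i < m, a i ≤ a (i + 1) then
      divDiff h.choose (schubert m k (raise h.choose a))
    else 0

lemma codim_pos {m i k : ℕ} (hi : i < m) {a : ℕ → ℕ} (ha : ∀ j, a j ≤ m - j)
    (hk : ∑ j ∈ range (m + 1), a j + k = ∑ j ∈ range (m + 1), (m - j)) (h : a i ≤ a (i + 1)) :
    0 < k := by
  have h1 := sum_raise hi a
  have h2 : ∑ j ∈ range (m + 1), raise i a j ≤ ∑ j ∈ range (m + 1), (m - j) :=
    sum_le_sum fun j _ => raise_le hi ha h j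
  omega

/-- The Schubert polynomial does not depend on the choice of the ascent. -/
lemma schubert_succ {m : ℕ} (k : ℕ) : ∀ {i : ℕ} (_ : i < m) {a : ℕ → ℕ} (_ : ∀ j, a j ≤ m - j)
    (_ : ∑ j ∈ range (m + 1), a j + (k + 1) = ∑ j ∈ range (m + 1), (m - j))
    (_ : a i ≤ a (i + 1)), schubert m (k + 1) a = divDiff i (schubert m k (raise i a)) := by
  induction k using Nat.strong_induction_on with
  | _ k ih =>
    have far : ∀ i j : ℕ, i + 2 ≤ j → i < m → j < m → ∀ a : ℕ → ℕ, (∀ j, a j ≤ m - j) →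
        ∑ j ∈ range (m + 1), a j + (k + 1) = ∑ j ∈ range (m + 1), (m - j) →
        a i ≤ a (i + 1) → a j ≤ a (j + 1) →
        divDiff i (schubert m k (raise i a)) = divDiff j (schubert m k (raise j a)) := by
      intro i j hij hi hj a ha hk h h'
      have si := sum_raise hi a
      have sj := sum_raise hj a
      have bi := raise_le hi ha h
      have bj := raise_le hj ha h'
      have ai : raise i a j ≤ raise i a (j + 1) := by
        simp only [raise]; split_ifs <;> omega
      have aj : raise j a i ≤ raise j a (i + 1) := by
        simp only [raise]; split_ifs <;> omega
      have pos := codim_pos hj bi (k := k) (by omega) ai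
      obtain ⟨k, rfl⟩ := Nat.exists_eq_succ_of_ne_zero pos.ne'
      rw [Nat.succ_eq_add_one, ih k (by omega) hj bi (by omega) ai,
        ih k (by omega) hi bj (by omega) aj, raise_comm hij, divDiff_comm hij]
    have near : ∀ i : ℕ, i + 1 < m → ∀ a : ℕ → ℕ, (∀ j, a j ≤ m - j) →
        ∑ j ∈ range (m + 1), a j + (k + 1) = ∑ j ∈ range (m + 1), (m - j) →
        a i ≤ a (i + 1) → a (i + 1) ≤ a (i + 1 + 1) →
        divDiff i (schubert m k (raise i a)) =
          divDiff (i + 1) (schubert m k (raise (i + 1) a)) := by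
      intro i hi' a ha hk h h'
      have hi : i < m := by omega
      have s1 := sum_raise hi a
      have t1 := sum_raise hi' a
      have b1 := raise_le hi ha h
      have c1 := raise_le hi' ha h'
      have d1 : raise i a (i + 1) ≤ raise i a (i + 1 + 1) := by
        simp only [raise]; split_ifs <;> omega
      have e1 : raise (i + 1) a i ≤ raise (i + 1) a (i + 1) := by
        simp only [raise]; split_ifs <;> omega
      have pos := codim_pos hi' b1 (k := k) (by omega) d1
      obtain ⟨k, rfl⟩ := Nat.exists_eq_succ_of_ne_zero pos.ne'
      have s2 := sum_raise hi' (raise i a)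
      have t2 := sum_raise hi (raise (i + 1) a)
      have b2 := raise_le hi' b1 d1
      have c2 := raise_le hi c1 e1
      have d2 : raise (i + 1) (raise i a) i ≤ raise (i + 1) (raise i a) (i + 1) := by
        simp only [raise]; split_ifs <;> omega
      have e2 : raise i (raise (i + 1) a) (i + 1) ≤ raise i (raise (i + 1) a) (i + 1 + 1) := by
        simp only [raise]; split_ifs <;> omega
      have pos := codim_pos hi b2 (k := k) (by omega) d2
      obtain ⟨k, rfl⟩ := Nat.exists_eq_succ_of_ne_zero pos.ne'
      simp only [Nat.succ_eq_add_one] at *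
      rw [ih (k + 1) (by omega) hi' b1 (by omega) d1, ih k (by omega) hi b2 (by omega) d2,
        ih (k + 1) (by omega) hi c1 (by omega) e1, ih k (by omega) hi' c2 (by omega) e2,
        raise_braid, divDiff_braid]
    intro i hi a ha hk h
    have hex : ∃ i < m, a i ≤ a (i + 1) := ⟨i, hi, h⟩
    rw [schubert, dif_pos hex]
    obtain ⟨hj, h'⟩ := hex.choose_spec
    generalize hex.choose = j at hj h'
    rcases (by omega : i = j ∨ i + 2 ≤ j ∨ j + 2 ≤ i ∨ j = i + 1 ∨ i = j + 1) with
      rfl | hij | hij | rfl | rfl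
    · rfl
    · exact (far i j hij hi hj a ha hk h h').symm
    · exact far j i hij hj hi a ha hk h' h
    · exact (near i hj a ha hk h h').symm
    · exact near j hi a ha hk h' h

lemma eq_of_codim_eq_zero {m : ℕ} {a : ℕ → ℕ} (ha : ∀ j, a j ≤ m - j)
    (hk : ∑ j ∈ range (m + 1), a j = ∑ j ∈ range (m + 1), (m - j)) : a = fun j => m - j := by
  have := (sum_eq_sum_iff_of_le fun j _ => ha j).1 hk
  funext j
  by_cases hj : j < m + 1
  · exact this j (mem_range.2 hj)
  · have := ha j
    omega

lemma exists_ascent {m k : ℕ} {a : ℕ → ℕ}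
    (hk : ∑ j ∈ range (m + 1), a j + (k + 1) = ∑ j ∈ range (m + 1), (m - j)) :
    ∃ i < m, a i ≤ a (i + 1) := by
  by_contra! H
  have key : ∀ d ≤ m, d ≤ a (m - d) := by
    intro d
    induction d with
    | zero => simp
    | succ d ih =>
      intro hd
      have h1 := ih (by omega)
      have h2 := H (m - (d + 1)) (by omega)
      rw [show m - (d + 1) + 1 = m - d by omega] at h2
      omega
  have : ∑ j ∈ range (m + 1), (m - j) ≤ ∑ j ∈ range (m + 1), a j := by
    refine sum_le_sum fun j hj => ?_
    have := key (m - j) (by omega)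
    rwa [show m - (m - j) = j by have := mem_range.1 hj; omega] at this
  omega

lemma codeMonomial_mem_staircase {m : ℕ} {a : ℕ → ℕ} (ha : ∀ j, a j ≤ m - j) :
    codeMonomial m a ∈ staircase m (∑ j ∈ range (m + 1), a j) := by
  refine Submodule.subset_span ⟨_, fun j => ?_, ?_, rfl⟩
  · rw [indicator_apply_of_le ha]
    exact ha j
  · exact sum_congr rfl fun j _ => indicator_apply_of_le ha j

lemma schubert_mem_staircase {m : ℕ} (k : ℕ) : ∀ {a : ℕ → ℕ} (_ : ∀ j, a j ≤ m - j)
    (_ : ∑ j ∈ range (m + 1), a j + k = ∑ j ∈ range (m + 1), (m - j)),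
    schubert m k a ∈ staircase m (∑ j ∈ range (m + 1), a j) := by
  induction k with
  | zero =>
    intro a ha hk
    have := eq_of_codim_eq_zero ha hk
    subst this
    exact codeMonomial_mem_staircase ha
  | succ k ih =>
    intro a ha hk
    obtain ⟨i, hi, h⟩ := exists_ascent hk
    rw [schubert_succ k hi ha hk h]
    have hs := sum_raise hi a
    have := ih (raise_le hi ha h) (by omega)
    rw [hs] at this
    exact divDiff_mem_staircase hi this

lemma divDiff_schubert_of_descent {m i k : ℕ} (hi : i < m) {a : ℕ → ℕ} (ha : ∀ j, a j ≤ m - j)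
    (hk : ∑ j ∈ range (m + 1), a j + k = ∑ j ∈ range (m + 1), (m - j)) (h : a (i + 1) < a i) :
    divDiff i (schubert m k a) = schubert m (k + 1) (lower i a) := by
  have hs := sum_lower hi h
  rw [schubert_succ k hi (lower_le ha h) (by omega), raise_lower h]
  simp only [lower]
  split_ifs <;> omega

lemma divDiff_schubert_of_ascent {m i k : ℕ} (hi : i < m) {a : ℕ → ℕ} (ha : ∀ j, a j ≤ m - j)
    (hk : ∑ j ∈ range (m + 1), a j + k = ∑ j ∈ range (m + 1), (m - j)) (h : a i ≤ a (i + 1)) :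
    divDiff i (schubert m k a) = 0 := by
  obtain ⟨k, rfl⟩ := Nat.exists_eq_succ_of_ne_zero (codim_pos hi ha hk h).ne'
  rw [Nat.succ_eq_add_one, schubert_succ k hi ha hk h, divDiff_divDiff]

lemma divDiff_codeMonomial_raise {m i : ℕ} (hi : i < m) {a : ℕ → ℕ} (ha : ∀ j, a j ≤ m - j)
    (h : a i = a (i + 1)) : divDiff i (codeMonomial m (raise i a)) = codeMonomial m a := by
  rw [codeMonomial, ← monomialUpdate_self i, indicator_apply_of_le (raise_le hi ha h.le),
    indicator_apply_of_le (raise_le hi ha h.le)]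
  have h1 : raise i a i = a i + 1 := by simp [raise, h]
  have h2 : raise i a (i + 1) = a i := by simp [raise]
  rw [h1, h2, divDiff_monomialUpdate_succ, monomialUpdate, codeMonomial]
  refine congrArg (monomial · (1 : ℚ)) (Finsupp.ext fun j => ?_)
  rw [update_update_apply, indicator_apply_of_le (raise_le hi ha h.le), indicator_apply_of_le ha]
  simp only [raise]
  split_ifs <;> first | rfl | (subst_vars; omega)

/-- The Schubert polynomial of a dominant permutation is a monomial. -/
lemma schubert_of_antitone {m : ℕ} (k : ℕ) : ∀ {a : ℕ → ℕ} (_ : Antitone a)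
    (_ : ∀ j, a j ≤ m - j)
    (_ : ∑ j ∈ range (m + 1), a j + k = ∑ j ∈ range (m + 1), (m - j)),
    schubert m k a = codeMonomial m a := by
  induction k with
  | zero =>
    intro a _ ha hk
    rw [eq_of_codim_eq_zero ha hk, schubert]
  | succ k ih =>
    intro a hanti ha hk
    have hex := exists_ascent hk
    obtain ⟨hi, h⟩ := Nat.find_spec hex
    have hmin := fun j => Nat.find_min hex (m := j)
    generalize Nat.find hex = i at hi h hmin
    have heq : a i = a (i + 1) := le_antisymm h (hanti i.le_succ)
    have hs := sum_raise hi a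
    have hraise : Antitone (raise i a) := by
      refine antitone_nat_of_succ_le fun j => ?_
      have h1 := hanti j.le_succ
      have h2 := hanti (show i ≤ i + 2 by omega)
      by_cases hj : j + 1 = i
      · have h3 := hmin j (by omega)
        subst hj
        simp only [raise]
        split_ifs <;> omega
      · simp only [raise]
        split_ifs <;> first | omega | (subst_vars; omega)
    rw [schubert_succ k hi ha hk h, ih hraise (raise_le hi ha h) (by omega),
      divDiff_codeMonomial_raise hi ha heq]

lemma weightMap_codeMonomial {m : ℕ} {a : ℕ → ℕ} (ha : ∀ j, a j ≤ m - j) :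
    weightMap m (codeMonomial m a) = betaWeight (m + 1) fun j => a j + (m - j) := by
  rw [codeMonomial, weightMap_monomial]
  simp only [indicator_apply_of_le ha]

/-- The list `p`, preceded by `z` zeros and followed by zeros, is the sequence `a`. -/
def Represents (p : List ℕ) (z : ℕ) (a : ℕ → ℕ) : Prop :=
  ∀ j, a j = if j < z then 0 else p.getD (j - z) 0

lemma exists_eq_replicate_append_dropWhile (l : List ℕ) :
    ∃ c, l = List.replicate c 0 ++ l.dropWhile (· == 0) := by
  refine ⟨(l.takeWhile (· == 0)).length, ?_⟩
  rw [← List.eq_replicate_of_mem (l := l.takeWhile (· == 0)) (a := 0), List.takeWhile_append_dropWhile]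
  intro b hb
  simpa using List.mem_takeWhile_imp hb

lemma exists_eq_trim (l : List ℕ) :
    ∃ c d, l = List.replicate c 0 ++ (trim l ++ List.replicate d 0) := by
  obtain ⟨c, hc⟩ := exists_eq_replicate_append_dropWhile l
  obtain ⟨d, hd⟩ := exists_eq_replicate_append_dropWhile (l.dropWhile (· == 0)).reverse
  refine ⟨c, d, ?_⟩
  have h := congrArg List.reverse hd
  rw [List.reverse_reverse, List.reverse_append, List.reverse_replicate] at h
  rw [trim, ← h, ← hc]

lemma trim_getD_last_ne_zero (l : List ℕ) (h : trim l ≠ []) :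
    (trim l).getD ((trim l).length - 1) 0 ≠ 0 := by
  have key : ∀ (u : List ℕ) (hu : u ≠ []), (u.head hu == 0) = false →
      u.reverse.getD (u.reverse.length - 1) 0 ≠ 0 := by
    intro u hu h0
    cases u with
    | nil => exact absurd rfl hu
    | cons x t => simpa [List.getD_eq_getElem?_getD] using h0
  have hne : (l.dropWhile (· == 0)).reverse.dropWhile (· == 0) ≠ [] := by
    intro h0
    exact h (by rw [trim, h0]; rfl)
  exact key _ hne (List.head_dropWhile_not (· == 0) hne)

lemma Represents.trim {l : List ℕ} {z : ℕ} {a : ℕ → ℕ} (h : Represents l z a) :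
    ∃ z', Represents (trim l) z' a := by
  obtain ⟨c, d, hl⟩ := exists_eq_trim l
  refine ⟨z + c, fun j => ?_⟩
  rw [h j]
  generalize _root_.trim l = t at hl
  subst hl
  simp only [List.getD_eq_getElem?_getD, List.getElem?_append, List.getElem?_replicate,
    List.length_replicate]
  split_ifs <;> first
    | omega
    | rfl
    | rw [Nat.sub_sub]
    | simp [List.getElem?_eq_none (show t.length ≤ j - (z + c) by omega)]

lemma numPlays_nil : {ms | run [] ms = some []}.Finite ∧ numPlays [] = 1 := by
  have : {ms | run [] ms = some []} = {[]} := by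
    ext ms
    cases ms with
    | nil => simp [run]
    | cons mv ms => cases mv <;> simp [run, applyMove]
  refine ⟨this ▸ Set.finite_singleton _, ?_⟩
  change Set.ncard {ms | run [] ms = some []} = 1
  rw [this, Set.ncard_singleton]

lemma numPlays_eq_sum {p : List ℕ} (hp : p ≠ []) (s : Finset ℕ) (mv : ℕ → Option ℕ)
    (q : ℕ → List ℕ) (hinj : Set.InjOn mv s) (hmv : ∀ i ∈ s, applyMove p (mv i) = some (q i))
    (hall : ∀ v, applyMove p v ≠ none → ∃ i ∈ s, mv i = v)
    (hfin : ∀ i ∈ s, {ms | run (q i) ms = some []}.Finite) :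
    {ms | run p ms = some []}.Finite ∧ numPlays p = ∑ i ∈ s, numPlays (q i) := by
  classical
  choose! t ht using fun i hi => (hfin i hi).exists_finset
  have hset : {ms | run p ms = some []} =
      (s.biUnion fun i => (t i).image (List.cons (mv i)) : Finset (List (Option ℕ))) := by
    ext ms
    simp only [Set.mem_ofPred_eq, coe_biUnion, coe_image, Set.mem_iUnion, Set.mem_image, mem_coe,
      exists_prop]
    constructor
    · intro h
      cases ms with
      | nil => simp [run, hp] at h
      | cons v ms =>
        rw [run] at h
        obtain ⟨i, hi, rfl⟩ := hall v fun h0 => by simp [h0] at h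
        rw [hmv i hi] at h
        exact ⟨i, hi, ms, (ht i hi ms).2 h, rfl⟩
    · rintro ⟨i, hi, ms, hms, rfl⟩
      rw [run, hmv i hi]
      exact (ht i hi ms).1 hms
  refine ⟨hset ▸ finite_toSet _, ?_⟩
  change Set.ncard {ms | run p ms = some []} = _
  rw [hset, Set.ncard_coe_finset, card_biUnion]
  · refine sum_congr rfl fun i hi => ?_
    rw [card_image_of_injective _ List.cons_injective, ← Set.ncard_coe_finset]
    exact congrArg Set.ncard (Set.ext (ht i hi))
  · intro i hi j hj hij
    rw [Function.onFun, disjoint_left]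
    intro ms h1 h2
    obtain ⟨_, _, rfl⟩ := mem_image.1 h1
    obtain ⟨_, _, h⟩ := mem_image.1 h2
    exact hij (hinj hi hj (List.cons.inj h).1.symm)

/-- The legal moves from a position are the descents of the code it represents. -/
lemma applyMove_of_descent {p : List ℕ} {z : ℕ} {a : ℕ → ℕ} (h : Represents p z a) {i : ℕ}
    (hi : a (i + 1) < a i) : z ≤ i ∧ i < z + p.length ∧
    ∃ q z', applyMove p (if i + 1 < z + p.length then some (i - z) else none) = some q ∧
      Represents q z' (lower i a) ∧ (q ≠ [] → q.getD (q.length - 1) 0 ≠ 0) := by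
  have hz : z ≤ i := by
    by_contra hlt
    have := h i
    rw [if_pos (by omega)] at this
    omega
  have hi0 := h i
  have hi1 := h (i + 1)
  rw [if_neg (by omega)] at hi0 hi1
  obtain ⟨i, rfl⟩ := Nat.exists_eq_add_of_le hz
  rw [show z + i - z = i by omega] at hi0
  rw [show z + i + 1 - z = i + 1 by omega] at hi1
  have hlen : i < p.length := by
    by_contra hlt
    rw [List.getD_eq_default _ _ (by omega)] at hi0
    omega
  refine ⟨hz, by omega, ?_⟩
  by_cases hlast : i + 1 < p.length
  · rw [if_pos (by omega), show z + i - z = i by omega, applyMove,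
      if_pos ⟨hlast, by omega⟩]
    obtain ⟨z', hz'⟩ : ∃ z', Represents (trim ((p.set i (p.getD (i + 1) 0)).set (i + 1)
        (p.getD i 0 - 1))) z' (lower (z + i) a) := by
      refine Represents.trim (z := z) fun j => ?_
      have hj := h j
      simp only [lower, hi0, hi1, hj]
      simp only [List.getD_eq_getElem?_getD, List.getElem?_set, List.length_set]
      split_ifs <;> first | omega | rfl
    exact ⟨_, z', rfl, hz', trim_getD_last_ne_zero _⟩
  · have hp : p ≠ [] := by rintro rfl; simp at hlen
    rw [if_neg (by omega), applyMove, if_neg hp]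
    obtain ⟨z', hz'⟩ : ∃ z', Represents (trim (p.dropLast ++ [0, p.getD (p.length - 1) 0 - 1])) z'
        (lower (z + i) a) := by
      refine Represents.trim (z := z) fun j => ?_
      have hj := h j
      simp only [lower, hi0, hi1, hj]
      simp only [List.getD_eq_getElem?_getD, List.getElem?_append, List.getElem?_dropLast,
        List.length_dropLast]
      split_ifs
      any_goals first | omega | rfl
      · rw [show j - z - (p.length - 1) = 0 by omega, List.getElem?_eq_none (by omega)]
        rfl
      · rw [show j - z - (p.length - 1) = 1 by omega, show p.length - 1 = i by omega]
        rfl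
      · rw [List.getElem?_eq_none (by omega), List.getElem?_eq_none (by simp; omega)]
    exact ⟨_, z', rfl, hz', trim_getD_last_ne_zero _⟩

lemma exists_descent_of_applyMove {p : List ℕ} {z : ℕ} {a : ℕ → ℕ} (h : Represents p z a)
    (hlast : p ≠ [] → p.getD (p.length - 1) 0 ≠ 0) {v : Option ℕ} (hv : applyMove p v ≠ none) :
    ∃ i, a (i + 1) < a i ∧ (if i + 1 < z + p.length then some (i - z) else none) = v := by
  cases v with
  | some i =>
    simp only [applyMove, ne_eq, ite_eq_right_iff, reduceCtorEq, imp_false, not_not] at hv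
    refine ⟨z + i, ?_, by rw [if_pos (by omega), Nat.add_sub_cancel_left]⟩
    rw [h, h, if_neg (by omega), if_neg (by omega), Nat.add_sub_cancel_left,
      show z + i + 1 - z = i + 1 by omega]
    exact hv.2
  | none =>
    have hp : p ≠ [] := by rintro rfl; simp [applyMove] at hv
    have hpos := List.length_pos_iff.2 hp
    refine ⟨z + (p.length - 1), ?_, by rw [if_neg (by omega)]⟩
    rw [h, h, if_neg (by omega), if_neg (by omega), Nat.add_sub_cancel_left,
      List.getD_eq_default _ _ (by omega)]
    exact Nat.pos_of_ne_zero (hlast hp)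

lemma numPlays_eq_weightMap {m : ℕ} (d : ℕ) : ∀ {a : ℕ → ℕ} (_ : ∀ j, a j ≤ m - j)
    (_ : ∑ j ∈ range (m + 1), a j = d) {k : ℕ} (_ : d + k = ∑ j ∈ range (m + 1), (m - j))
    {p : List ℕ} {z : ℕ} (_ : Represents p z a) (_ : p ≠ [] → p.getD (p.length - 1) 0 ≠ 0),
    {ms | run p ms = some []}.Finite ∧
      (numPlays p : ℚ) = d.factorial * weightMap m (schubert m k a) := by
  induction d with
  | zero =>
    intro a ha hd k hk p z hrep hlast
    have ha0 : a = fun _ => 0 := by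
      funext j
      by_cases hj : j < m + 1
      · exact sum_eq_zero_iff.1 hd j (mem_range.2 hj)
      · have := ha j
        omega
    have hp : p = [] := by
      by_contra hp
      have hpos := List.length_pos_iff.2 hp
      have := hrep (z + (p.length - 1))
      rw [if_neg (by omega), Nat.add_sub_cancel_left, ha0] at this
      exact hlast hp this.symm
    subst hp ha0
    refine ⟨numPlays_nil.1, ?_⟩
    rw [numPlays_nil.2, schubert_of_antitone k antitone_const ha (by simpa using hk),
      weightMap_codeMonomial ha]
    have := betaWeight_eq_of_le (Nat.zero_le (m + 1)) (fun _ => 0) fun _ _ => rfl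
    rw [Nat.add_sub_cancel] at this
    rw [this]
    simp [betaWeight]
  | succ d ih =>
    intro a ha hd k hk p z hrep hlast
    have hp : p ≠ [] := by
      rintro rfl
      have : ∑ j ∈ range (m + 1), a j = 0 := sum_eq_zero fun j _ => by rw [hrep j]; simp
      omega
    have hdesc : ∀ i, a (i + 1) < a i → i < m := fun i hi => by
      have := ha i
      omega
    choose! hz hlt q z' hq hq' hlast' using
      fun (i : ℕ) (hi : i ∈ {i ∈ range m | a (i + 1) < a i}) =>
        applyMove_of_descent hrep (mem_filter.1 hi).2
    have hsub : ∀ i ∈ {i ∈ range m | a (i + 1) < a i}, {ms | run (q i) ms = some []}.Finite ∧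
        (numPlays (q i) : ℚ) = d.factorial * weightMap m (schubert m (k + 1) (lower i a)) := by
      intro i hi
      obtain ⟨hi1, hi2⟩ := mem_filter.1 hi
      have hs := sum_lower (mem_range.1 hi1) hi2
      exact ih (lower_le ha hi2) (by omega) (by omega) (hq' i hi) (hlast' i hi)
    obtain ⟨hfin, hsum⟩ := numPlays_eq_sum hp {i ∈ range m | a (i + 1) < a i} _ q
      (fun i hi j hj hij => by
        have := hz i hi
        have := hz j hj
        have := hlt i hi
        have := hlt j hj
        split_ifs at hij <;> simp at hij <;> omega) hq
      (fun v hv => by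
        obtain ⟨i, hi, rfl⟩ := exists_descent_of_applyMove hrep hlast hv
        exact ⟨i, by simp [hi, hdesc i hi], rfl⟩) (fun i hi => (hsub i hi).1)
    refine ⟨hfin, ?_⟩
    have hmem := schubert_mem_staircase k ha (by omega)
    rw [hd] at hmem
    rw [hsum, Nat.cast_sum, sum_congr rfl fun i hi => (hsub i hi).2, ← mul_sum,
      Nat.factorial_succ, Nat.cast_mul, mul_right_comm, Nat.cast_succ, ← sum_weightMap_divDiff hmem,
      mul_comm, sum_filter]
    congr 1
    refine sum_congr rfl fun i hi => ?_
    split_ifs with h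
    · rw [divDiff_schubert_of_descent (mem_range.1 hi) ha (by omega) h]
    · rw [divDiff_schubert_of_ascent (mem_range.1 hi) ha (by omega) (by omega), map_zero]

theorem stanley_solitaire_formula (k : ℕ) (a : Fin k → ℕ)
    (hmono : ∀ i j : Fin k, i ≤ j → a j ≤ a i) (hpos : ∀ i, 0 < a i) :
    (numPlays (List.ofFn a) : ℚ) =
      (Nat.factorial (∑ i, a i) : ℚ) /
        (∏ i : Fin k, (Nat.factorial (a i + (k - 1 - (i : ℕ))) : ℚ)) *
      ∏ i : Fin k, ∏ j ∈ Finset.Ioi i,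
        ((a i : ℚ) - (a j : ℚ) + ((j : ℕ) : ℚ) - ((i : ℕ) : ℚ)) := by
  set b : ℕ → ℕ := fun j => if h : j < k then a ⟨j, h⟩ else 0 with hb
  have hba : ∀ i : Fin k, b i = a i := fun i => by simp [hb]
  have hb0 : ∀ j, k ≤ j → b j = 0 := fun j hj => by simp [hb, hj]
  have hanti : Antitone b := by
    intro i j hij
    simp only [hb]
    split_ifs with h1 h2
    · exact hmono _ _ hij
    · omega
    · exact Nat.zero_le _
    · exact le_rfl
  set m := k + ∑ i, a i with hm
  have hle : ∀ j, b j ≤ m - j := by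
    intro j
    simp only [hb]
    split_ifs with h
    · have := single_le_sum (fun i _ => Nat.zero_le (a i)) (mem_univ (⟨j, h⟩ : Fin k))
      omega
    · exact Nat.zero_le _
  have hsum : ∑ j ∈ range (m + 1), b j = ∑ i, a i := by
    rw [← sum_subset (range_subset_range.2 (by omega : k ≤ m + 1))
      fun j _ hj => hb0 j (by simpa using hj), ← Fin.sum_univ_eq_sum_range]
    simp only [hba]
  obtain ⟨c, hc⟩ := Nat.exists_eq_add_of_le
    (hsum ▸ sum_le_sum fun j _ => hle j : ∑ i, a i ≤ ∑ j ∈ range (m + 1), (m - j))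
  have hrep : Represents (List.ofFn a) 0 b := by
    intro j
    simp only [hb, not_lt_zero, if_false, Nat.sub_zero, List.getD_eq_getElem?_getD,
      List.getElem?_ofFn]
    split_ifs <;> rfl
  have hlast : List.ofFn a ≠ [] → (List.ofFn a).getD ((List.ofFn a).length - 1) 0 ≠ 0 := by
    intro h
    have hk : k - 1 < k := by
      have := List.length_pos_iff.2 h
      rw [List.length_ofFn] at this
      omega
    have := hrep (k - 1)
    rw [if_neg (by omega), Nat.sub_zero] at this
    rw [List.length_ofFn, ← this, hba ⟨k - 1, hk⟩]
    exact (hpos _).ne'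
  rw [(numPlays_eq_weightMap _ hle hsum hc.symm hrep hlast).2,
    schubert_of_antitone c hanti hle (by omega), weightMap_codeMonomial hle]
  have := betaWeight_eq_of_le (by omega : k ≤ m + 1) b hb0
  rw [Nat.add_sub_cancel] at this
  rw [this, betaWeight, div_mul_eq_mul_div, mul_div_assoc]
  congr 2
  · rw [← prod_prod_Ioi k fun i j => ((b i + (k - 1 - i) : ℕ) : ℚ) - (b j + (k - 1 - j) : ℕ)]
    refine prod_congr rfl fun i _ => prod_congr rfl fun j _ => ?_
    have hi := i.2
    have hj := j.2
    rw [hba, hba, Nat.sub_sub, Nat.sub_sub]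
    push_cast [show 1 + (i : ℕ) ≤ k by omega, show 1 + (j : ℕ) ≤ k by omega]
    ring
  · rw [← Fin.prod_univ_eq_prod_range fun j => ((b j + (k - 1 - j)).factorial : ℚ)]
    simp only [hba]
end

section
/- For natural numbers a_1 ≥ a_2 > 0, the number of ways to play Stanley Solitaire to completion starting from the position [a_1, a_2] equals ( (a_1 + a_2)! / ( (a_1+1)! · a_2! ) ) · (a_1 − a_2 + 1). -/
/-- Exactly `k` sequences of legal moves lead from `p` to the empty position. -/
def HasPlayCount (p : List ℕ) (k : ℕ) : Prop :=
  ∃ s : Finset (List (Option ℕ)), (∀ ms, ms ∈ s ↔ run p ms = some []) ∧ s.card = k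

/-- The binomial coefficient `n.choose (e - 1)`, with value `0` at `e = 0`. -/
def choosePred (n : ℕ) : ℕ → ℕ
  | 0 => 0
  | e + 1 => n.choose e

theorem choosePred_succ_succ (n e : ℕ) :
    choosePred (n + 1) (e + 1) = choosePred n e + choosePred n (e + 1) := by
  cases e with
  | zero => simp [choosePred]
  | succ e => simp [choosePred, Nat.choose_succ_succ]

theorem HasPlayCount.numPlays_eq {p : List ℕ} {k : ℕ} (h : HasPlayCount p k) :
    numPlays p = k := by
  obtain ⟨s, hs, rfl⟩ := h
  exact Nat.subtype_card s hs

theorem hasPlayCount_nil : HasPlayCount [] 1 := by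
  refine ⟨{[]}, fun ms => ?_, rfl⟩
  rcases ms with _ | ⟨_ | i, ms⟩ <;> simp [run, applyMove]

theorem HasPlayCount.of_unique_move {p q : List ℕ} {m : Option ℕ} {k : ℕ} (hp : p ≠ [])
    (hm : applyMove p m = some q) (h : ∀ m', m' ≠ m → applyMove p m' = none)
    (hq : HasPlayCount q k) : HasPlayCount p k := by
  obtain ⟨s, hs, rfl⟩ := hq
  refine ⟨s.map ⟨List.cons m, List.cons_injective⟩, fun ms => ?_, Finset.card_map _⟩
  rcases ms with _ | ⟨m', ms⟩
  · simp [run, hp]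
  · by_cases e : m' = m
    · subst e
      simp [run, hm, hs]
    · simp [run, h m' e, Ne.symm e]

theorem HasPlayCount.of_two_moves {p q q' : List ℕ} {m m' : Option ℕ} {k k' : ℕ} (hp : p ≠ [])
    (hne : m ≠ m') (hm : applyMove p m = some q) (hm' : applyMove p m' = some q')
    (h : ∀ m'', m'' ≠ m → m'' ≠ m' → applyMove p m'' = none)
    (hq : HasPlayCount q k) (hq' : HasPlayCount q' k') : HasPlayCount p (k + k') := by
  obtain ⟨s, hs, rfl⟩ := hq
  obtain ⟨s', hs', rfl⟩ := hq'
  refine ⟨(s.map ⟨List.cons m, List.cons_injective⟩).disjUnion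
    (s'.map ⟨List.cons m', List.cons_injective⟩) ?_, fun ms => ?_, ?_⟩
  · rw [Finset.disjoint_left]
    simp only [Finset.mem_map, Function.Embedding.coeFn_mk]
    rintro _ ⟨x, _, rfl⟩ ⟨y, _, hy⟩
    exact hne (List.cons.inj hy).1.symm
  · rcases ms with _ | ⟨m'', ms⟩
    · simp [run, hp]
    · by_cases e : m'' = m
      · subst e
        simp [run, hm, hs, hne.symm]
      · by_cases e' : m'' = m'
        · subst e'
          simp [run, hm', hs', Ne.symm e]
        · simp [run, h m'' e e', Ne.symm e, Ne.symm e']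
  · rw [Finset.card_disjUnion, Finset.card_map, Finset.card_map]

theorem trim_zero_cons (l : List ℕ) : trim (0 :: l) = trim l := by
  simp [trim]

theorem trim_replicate_zero_append (e : ℕ) (l : List ℕ) :
    trim (List.replicate e 0 ++ l) = trim l := by
  induction e with
  | zero => rfl
  | succ e ih => rw [List.replicate_succ, List.cons_append, trim_zero_cons, ih]

theorem trim_singleton {a : ℕ} (ha : a ≠ 0) : trim [a] = [a] := by
  simp [trim, ha]

theorem trim_cons_replicate_append_zero {a : ℕ} (ha : a ≠ 0) (e : ℕ) :
    trim (a :: (List.replicate e 0 ++ [0])) = [a] := by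
  have h : (List.replicate e 0 ++ [a]).dropWhile (· == 0) = [a] := by
    induction e with
    | zero => simp [ha]
    | succ e ih => simpa [List.replicate_succ] using ih
  simp [trim, ha, h]

theorem trim_two_piles {a b : ℕ} (ha : a ≠ 0) (hb : b ≠ 0) (e : ℕ) :
    trim (a :: (List.replicate e 0 ++ [b])) = a :: (List.replicate e 0 ++ [b]) := by
  simp [trim, ha, hb]

theorem hasPlayCount_trim_singleton (a : ℕ) : HasPlayCount (trim [a]) 1 := by
  induction a with
  | zero => exact hasPlayCount_nil
  | succ a ih =>
    rw [trim_singleton (Nat.succ_ne_zero a)]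
    refine HasPlayCount.of_unique_move (m := none) (by simp) ?_ ?_ ih
    · simp [applyMove, trim_zero_cons]
    · rintro (_ | i) hi
      · exact absurd rfl hi
      · simp [applyMove]

theorem applyMove_none_two_piles (a b e : ℕ) :
    applyMove (a :: (List.replicate e 0 ++ [b])) none =
      some (trim (a :: (List.replicate (e + 1) 0 ++ [b - 1]))) := by
  have h : (a :: (List.replicate e 0 ++ [b])).dropLast = a :: List.replicate e 0 := by
    rw [← List.cons_append, List.dropLast_concat]
  simp [applyMove, h, List.replicate_succ']

theorem applyMove_some_succ_two_piles (a b e i : ℕ) :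
    applyMove (a :: (List.replicate e 0 ++ [b])) (some (i + 1)) = none := by
  rw [applyMove, if_neg]
  rintro ⟨h₁, h₂⟩
  have hi : i < e := by simpa using h₁
  simp [List.getD_eq_getElem?_getD, List.getElem?_append, hi] at h₂

theorem applyMove_some_zero_two_piles {a : ℕ} (ha : a ≠ 0) (b e : ℕ) :
    applyMove (a :: (List.replicate (e + 1) 0 ++ [b])) (some 0) =
      some (trim ((a - 1) :: (List.replicate e 0 ++ [b]))) := by
  simp [applyMove, List.replicate_succ, Nat.pos_of_ne_zero ha, trim_zero_cons]

theorem exists_hasPlayCount_two_piles (a b e : ℕ) :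
    ∃ k, HasPlayCount (trim (a :: (List.replicate e 0 ++ [b]))) k ∧
      k + choosePred (a + b) (min (a - e) b) = (a + b).choose b := by
  obtain ⟨n, hn⟩ : ∃ n, a + b = n := ⟨_, rfl⟩
  induction n generalizing a b e with
  | zero =>
    obtain ⟨rfl, rfl⟩ : a = 0 ∧ b = 0 := by omega
    refine ⟨1, ?_, by simp [choosePred]⟩
    rw [trim_zero_cons, trim_replicate_zero_append]
    exact hasPlayCount_trim_singleton 0
  | succ n ih =>
    rcases a with _ | a
    · refine ⟨1, ?_, by simp [choosePred]⟩
      rw [trim_zero_cons, trim_replicate_zero_append]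
      exact hasPlayCount_trim_singleton b
    rcases b with _ | b
    · refine ⟨1, ?_, by simp [choosePred]⟩
      rw [trim_cons_replicate_append_zero (by simp), ← trim_singleton (by simp)]
      exact hasPlayCount_trim_singleton (a + 1)
    rw [trim_two_piles (by simp) (by simp), hn, Nat.choose_succ_succ']
    obtain ⟨k, hk, hk'⟩ := ih (a + 1) b (e + 1) (by omega)
    rw [show a + 1 + b = n by omega, Nat.add_sub_add_right] at hk'
    have hnone := applyMove_none_two_piles (a + 1) (b + 1) e
    rcases e with _ | e
    · by_cases hba : b < a
      · obtain ⟨l, hl, hl'⟩ := ih (b + 1) a 0 (by omega)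
        refine ⟨k + l, HasPlayCount.of_two_moves (m := none) (m' := some 0) (by simp) (by simp)
          hnone (q' := trim [b + 1, a]) ?_ ?_ hk hl, ?_⟩
        · simp [applyMove, hba]
        · rintro (_ | _ | i) h₁ h₂
          · exact absurd rfl h₁
          · exact absurd rfl h₂
          · exact applyMove_some_succ_two_piles _ _ 0 _
        · have hp := choosePred_succ_succ n b
          have hs : n.choose a = n.choose (b + 1) :=
            Nat.choose_symm_of_eq_add (by omega)
          rw [show b + 1 + a = n by omega, show min (b + 1 - 0) a = b + 1 by omega, hs] at hl'
          rw [show min (a - 0) b = b by omega] at hk'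
          rw [show min (a + 1 - 0) (b + 1) = b + 1 by omega]
          omega
      · refine ⟨k, HasPlayCount.of_unique_move (m := none) (by simp) hnone ?_ hk, ?_⟩
        · rintro (_ | _ | i) h
          · exact absurd rfl h
          · simp [applyMove]
            omega
          · exact applyMove_some_succ_two_piles _ _ 0 _
        · have hp := choosePred_succ_succ n a
          have hs : n.choose a = n.choose (b + 1) :=
            Nat.choose_symm_of_eq_add (by omega)
          have hc : choosePred n (a + 1) = n.choose a := rfl
          rw [show min (a - 0) b = a by omega] at hk'
          rw [show min (a + 1 - 0) (b + 1) = a + 1 by omega]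
          omega
    · obtain ⟨l, hl, hl'⟩ := ih a (b + 1) e (by omega)
      refine ⟨k + l, HasPlayCount.of_two_moves (m := none) (m' := some 0) (by simp) (by simp)
        hnone (applyMove_some_zero_two_piles (by simp) _ _) ?_ hk hl, ?_⟩
      · rintro (_ | _ | i) h₁ h₂
        · exact absurd rfl h₁
        · exact absurd rfl h₂
        · exact applyMove_some_succ_two_piles _ _ _ _
      · rw [show a + (b + 1) = n by omega] at hl'
        rw [Nat.add_sub_add_right]
        rcases hd : a - e with _ | d
        · rw [show a - (e + 1) = 0 by omega] at hk'
          rw [hd] at hl'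
          simp only [Nat.zero_min, choosePred] at *
          omega
        · rw [show a - (e + 1) = d by omega] at hk'
          rw [hd, Nat.add_min_add_right] at hl'
          rw [Nat.add_min_add_right, choosePred_succ_succ]
          omega

theorem stanley_solitaire_two_pile_formula (a₁ a₂ : ℕ) (h : a₂ ≤ a₁) (h' : 0 < a₂) :
    (numPlays [a₁, a₂] : ℚ) =
      (Nat.factorial (a₁ + a₂) : ℚ) /
        ((Nat.factorial (a₁ + 1) : ℚ) * (Nat.factorial a₂ : ℚ)) *
      ((a₁ : ℚ) - (a₂ : ℚ) + 1) := by
  obtain ⟨k, hk, hk'⟩ := exists_hasPlayCount_two_piles a₁ a₂ 0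
  rw [trim_two_piles (by omega) (by omega)] at hk
  obtain ⟨b, rfl⟩ : ∃ b, a₂ = b + 1 := ⟨a₂ - 1, by omega⟩
  rw [show numPlays [a₁, b + 1] = k from hk.numPlays_eq]
  rw [show min (a₁ - 0) (b + 1) = b + 1 by omega] at hk'
  have hq : (k : ℚ) + ((a₁ + (b + 1)).choose b : ℚ) = ((a₁ + (b + 1)).choose (b + 1) : ℚ) :=
    mod_cast hk'
  rw [Nat.cast_choose ℚ (by omega : b ≤ a₁ + (b + 1)),
    Nat.cast_choose ℚ (by omega : b + 1 ≤ a₁ + (b + 1)),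
    show a₁ + (b + 1) - b = a₁ + 1 by omega, show a₁ + (b + 1) - (b + 1) = a₁ by omega] at hq
  rw [eq_sub_of_add_eq hq]
  simp only [Nat.factorial_succ a₁, Nat.factorial_succ b]
  push_cast
  field_simp
  ring
end

section
/- For every n ≥ 2, the number of sequences (i_1, …, i_N) with N = n(n−1)/2, each i_j ∈ {1, …, n−1}, such that the product of adjacent transpositions s_{i_1} s_{i_2} ⋯ s_{i_N} (where s_i swaps i and i+1) equals the longest permutation n, n−1, …, 1 of {1,…,n}, is equal to the number of standard Young tableaux of staircase shape (n−1, n−2, …, 1). -/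
/-- The adjacent transposition `s i` of `{1,…,n}` (as `Fin n`), swapping positions
`i` and `i+1` (for `i ∈ {1,…,n-1}`, encoded as `i : Fin (n-1)`). -/
def adjTransposition {n : ℕ} (i : Fin (n - 1)) : Equiv.Perm (Fin n) :=
  Equiv.swap ⟨i.val, lt_of_lt_of_le i.isLt (Nat.sub_le n 1)⟩
    ⟨i.val + 1, by have h := i.isLt; omega⟩

/-- The cells of the staircase Young diagram `(n-1, n-2, …, 1)`: row `i` (0-indexed)
has length `n-1-i`, i.e. cell `(i, j)` is present iff `i + j < n - 1`. -/
def StaircaseCell (n : ℕ) := {c : ℕ × ℕ // c.1 + c.2 < n - 1}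

/-- A standard Young tableau of staircase shape `(n-1, n-2, …, 1)`: a bijective filling of
the cells by `1, 2, …, n(n-1)/2` (encoded as `Fin (n*(n-1)/2)`), strictly increasing along
each row (left to right) and each column (top to bottom). -/
def IsStaircaseSYT (n : ℕ) (T : StaircaseCell n → Fin (n * (n - 1) / 2)) : Prop :=
  Function.Bijective T ∧
    (∀ c d : StaircaseCell n, c.1.1 = d.1.1 → c.1.2 < d.1.2 → T c < T d) ∧
    (∀ c d : StaircaseCell n, c.1.2 = d.1.2 → c.1.1 < d.1.1 → T c < T d)

open Polynomial

/-- The defining relations of the nilCoxeter algebra of type `A`. -/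
structure IsNilCoxeter {Q : Type*} [Ring Q] (u : ℕ → Q) : Prop where
  sq : ∀ i, u i * u i = 0
  braid : ∀ i, u i * u (i + 1) * u i = u (i + 1) * u i * u (i + 1)
  comm : ∀ i j, i + 2 ≤ j → u j * u i = u i * u j

/-- The product `(1 + x u_{m-1}) ⋯ (1 + x u_0)`. -/
def nilProd {Q : Type*} [Ring Q] (u : ℕ → Q) (x : Q) : ℕ → Q
  | 0 => 1
  | m + 1 => (1 + x * u m) * nilProd u x m

section NilProd

variable {Q : Type*} [Ring Q] {u : ℕ → Q}

theorem map_nilProd {P : Type*} [Ring P] (f : Q →+* P) (u : ℕ → Q) (x : Q) (m : ℕ) :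
    f (nilProd u x m) = nilProd (fun i => f (u i)) (f x) m := by
  induction m with
  | zero => simp [nilProd]
  | succ m ih => simp [nilProd, ih]

theorem one_add_mul_one_add {a x y : Q} (ha : a * a = 0) (hy : a * y = y * a) :
    (1 + x * a) * (1 + y * a) = 1 + (x + y) * a := by
  have : x * a * (y * a) = 0 := by
    rw [mul_assoc, ← mul_assoc a, hy, mul_assoc, ha, mul_zero, mul_zero]
  rw [add_mul, mul_add, mul_add, this]
  noncomm_ring

theorem yang_baxter {a b x y : Q} (ha : a * a = 0) (hb : b * b = 0)
    (hab : a * b * a = b * a * b) (hax : a * x = x * a) (hbx : b * x = x * b)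
    (hay : a * y = y * a) (hby : b * y = y * b) (hxy : y * x = x * y) :
    (1 + x * a) * (1 + (x + y) * b) * (1 + y * a) =
      (1 + y * b) * (1 + (x + y) * a) * (1 + x * b) := by
  have h1 (z : Q) : a * (x * z) = x * (a * z) := by rw [← mul_assoc, hax, mul_assoc]
  have h2 (z : Q) : b * (x * z) = x * (b * z) := by rw [← mul_assoc, hbx, mul_assoc]
  have h3 (z : Q) : a * (y * z) = y * (a * z) := by rw [← mul_assoc, hay, mul_assoc]
  have h4 (z : Q) : b * (y * z) = y * (b * z) := by rw [← mul_assoc, hby, mul_assoc]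
  have h5 (z : Q) : y * (x * z) = x * (y * z) := by rw [← mul_assoc, hxy, mul_assoc]
  rw [mul_assoc, mul_assoc] at hab
  simp only [mul_add, add_mul, mul_one, one_mul, mul_assoc, h1, h2, h3, h4, h5, hab, ha, hb,
    mul_zero]
  abel

theorem commute_nilProd_of_le {v x : Q} (hx : v * x = x * v) {m : ℕ}
    (hv : ∀ i < m, v * u i = u i * v) : v * nilProd u x m = nilProd u x m * v := by
  induction m with
  | zero => simp [nilProd]
  | succ m ih =>
    have h := hv m (by omega)
    have : v * (1 + x * u m) = (1 + x * u m) * v := by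
      rw [mul_add, add_mul, ← mul_assoc, hx, mul_assoc, h]
      simp [mul_assoc]
    rw [nilProd, ← mul_assoc, this, mul_assoc, ih fun i hi => hv i (by omega), mul_assoc]

theorem IsNilCoxeter.nilProd_comm (hu : IsNilCoxeter u) {x y : Q}
    (hx : ∀ i, u i * x = x * u i) (hy : ∀ i, u i * y = y * u i) (hxy : y * x = x * y) (m : ℕ) :
    nilProd u x m * nilProd u y m = nilProd u y m * nilProd u x m := by
  induction m using Nat.twoStepInduction with
  | zero => rfl
  | one =>
    simp only [nilProd, mul_one]
    rw [one_add_mul_one_add (hu.sq 0) (hy 0), one_add_mul_one_add (hu.sq 0) (hx 0), add_comm x]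
  | more m _ ih =>
    have far {z w : Q} (hz : ∀ i, u i * z = z * u i) (hzw : z * w = w * z)
        (hw : ∀ i, u i * w = w * u i) :
        nilProd u z m * (1 + w * u (m + 1)) = (1 + w * u (m + 1)) * nilProd u z m := by
      refine (commute_nilProd_of_le ?_ fun i hi => ?_).symm
      · rw [add_mul, mul_add, ← mul_assoc z, hzw, mul_assoc, hz, mul_assoc]; simp
      · rw [add_mul, mul_add, ← mul_assoc (u i), hw, mul_assoc, hu.comm i (m + 1) (by omega),
          mul_assoc]; simp
    have cancel {z w : Q} (hz : ∀ i, u i * z = z * u i) (hw : ∀ i, u i * w = w * u i) (i : ℕ) :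
        (1 + z * u i) * (1 + w * u i) = 1 + (z + w) * u i :=
      one_add_mul_one_add (hu.sq i) (hw i)
    have hnx : ∀ i, u i * (-x) = -x * u i := fun i => by simp [hx]
    have hyx : ∀ i, u i * (y - x) = (y - x) * u i := fun i => by rw [mul_sub, sub_mul, hx, hy]
    have key : nilProd u x m * nilProd u y (m + 1) =
        (1 + (y - x) * u m) * (nilProd u y m * nilProd u x (m + 1)) := by
      have h1 : nilProd u x m = (1 + -x * u m) * nilProd u x (m + 1) := by
        rw [nilProd, ← mul_assoc, cancel hnx hx]; simp
      rw [h1, mul_assoc, ih, nilProd, mul_assoc, ← mul_assoc, cancel hnx hy, ← sub_eq_neg_add]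
    have yb := yang_baxter (hu.sq m) (hu.sq (m + 1)) (hu.braid m) (hx m) (hx (m + 1)) (hyx m)
      (hyx (m + 1)) (show (y - x) * x = x * (y - x) by rw [sub_mul, mul_sub, hxy])
    rw [add_sub_cancel] at yb
    have e1 (z : Q) : nilProd u z (m + 2) =
        (1 + z * u (m + 1)) * ((1 + z * u m) * nilProd u z m) := rfl
    have e2 (z : Q) : nilProd u z (m + 2) = (1 + z * u (m + 1)) * nilProd u z (m + 1) := rfl
    calc nilProd u x (m + 2) * nilProd u y (m + 2)
        = (1 + x * u (m + 1)) * (1 + x * u m) *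
            (nilProd u x m * (1 + y * u (m + 1))) * nilProd u y (m + 1) := by
          rw [e1 x, e2 y]; simp only [mul_assoc]
      _ = (1 + x * u (m + 1)) * ((1 + x * u m) * (1 + y * u (m + 1))) *
            (nilProd u x m * nilProd u y (m + 1)) := by
          rw [far hx hxy.symm hy]; simp only [mul_assoc]
      _ = (1 + x * u (m + 1)) * ((1 + x * u m) * (1 + y * u (m + 1)) * (1 + (y - x) * u m)) *
            (nilProd u y m * nilProd u x (m + 1)) := by
          rw [key]; simp only [mul_assoc]
      _ = (1 + y * u (m + 1)) * (1 + y * u m) * ((1 + x * u (m + 1)) * nilProd u y m) *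
            nilProd u x (m + 1) := by
          rw [yb]
          simp only [← mul_assoc]
          rw [cancel hx hyx, add_sub_cancel]
      _ = nilProd u y (m + 2) * nilProd u x (m + 2) := by
          rw [← far hy hxy hx, e1 y, e2 x]; simp only [mul_assoc]

/-- The coefficients of `(1 + X u_{m-1}) ⋯ (1 + X u_0)`, extended by zero to `ℤ`. -/
noncomputable def nilElem (u : ℕ → Q) (m : ℕ) (k : ℤ) : Q :=
  if 0 ≤ k then (nilProd (fun i => C (u i)) X m).coeff k.toNat else 0

theorem nilElem_natCast (u : ℕ → Q) (m k : ℕ) :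
    nilElem u m k = (nilProd (fun i => C (u i)) X m).coeff k := by
  simp [nilElem]

theorem nilElem_of_neg (u : ℕ → Q) (m : ℕ) {k : ℤ} (hk : k < 0) : nilElem u m k = 0 := by
  simp [nilElem, hk.not_ge]

theorem nilProd_coeff_zero (u : ℕ → Q) (m : ℕ) :
    (nilProd (fun i => C (u i)) X m).coeff 0 = 1 := by
  induction m with
  | zero => simp [nilProd]
  | succ m ih => simp [nilProd, mul_coeff_zero, ih]

theorem nilElem_zero (u : ℕ → Q) (m : ℕ) : nilElem u m 0 = 1 :=
  (nilElem_natCast u m 0).trans (nilProd_coeff_zero u m)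

theorem nilElem_one (u : ℕ → Q) (m : ℕ) : nilElem u m 1 = ∑ i ∈ Finset.range m, u i := by
  have h := nilElem_natCast u m 1
  rw [Nat.cast_one] at h
  rw [h]
  clear h
  induction m with
  | zero => simp [nilProd, coeff_one]
  | succ m ih =>
    rw [Finset.sum_range_succ, nilProd, add_mul, coeff_add, one_mul, ih, mul_assoc, ← zero_add 1,
      coeff_X_mul, coeff_C_mul, nilProd_coeff_zero, mul_one]

theorem IsNilCoxeter.nilElem_comm (hu : IsNilCoxeter u) (m : ℕ) (j k : ℤ) :
    nilElem u m j * nilElem u m k = nilElem u m k * nilElem u m j := by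
  rcases lt_or_ge j 0 with hj | hj
  · simp [nilElem_of_neg u m hj]
  rcases lt_or_ge k 0 with hk | hk
  · simp [nilElem_of_neg u m hk]
  lift j to ℕ using hj
  lift k to ℕ using hk
  rw [nilElem_natCast, nilElem_natCast]
  set P : Q[X] := nilProd (fun i => C (u i)) X m with hP
  have hv : IsNilCoxeter (fun i => (C (C (u i)) : Q[X][X])) :=
    ⟨fun i => by simp only [← C_mul, hu.sq, C_0], fun i => by simp only [← C_mul, hu.braid],
      fun i j hij => by simp only [← C_mul, hu.comm i j hij]⟩
  have h := hv.nilProd_comm (x := C X) (y := X)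
    (fun i => by rw [← C_mul, ← C_mul, X_mul_C]) (fun i => by rw [X_mul_C])
    (by rw [X_mul_C]) m
  have h1 : nilProd (fun i => (C (C (u i)) : Q[X][X])) (C X) m = C P := by
    rw [hP, map_nilProd C]
  have h2 : nilProd (fun i => (C (C (u i)) : Q[X][X])) X m = P.map C := by
    rw [hP, ← coe_mapRingHom, map_nilProd]; simp
  rw [h1, h2] at h
  have h3 := congrArg (fun p : Q[X][X] => (p.coeff k).coeff j) h
  simpa [coeff_C_mul, coeff_mul_C, coeff_map] using h3

/-- The inverse of `nilProd`. -/
noncomputable def nilInv (u : ℕ → Q) : ℕ → Q[X]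
  | 0 => 1
  | m + 1 => nilInv u m * (1 + -X * C (u m))

theorem natDegree_nilInv_le (u : ℕ → Q) (m : ℕ) : (nilInv u m).natDegree ≤ m := by
  induction m with
  | zero => simp [nilInv]
  | succ m ih =>
    refine natDegree_mul_le.trans (add_le_add ih ?_)
    refine (natDegree_add_le _ _).trans (max_le (by simp) ?_)
    refine natDegree_mul_le.trans ?_
    rw [natDegree_neg, natDegree_C, add_zero]
    exact natDegree_X_le

theorem IsNilCoxeter.nilProd_mul_nilInv (hu : IsNilCoxeter u) (m : ℕ) :
    nilProd (fun i => C (u i)) X m * nilInv u m = 1 := by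
  induction m with
  | zero => simp [nilProd, nilInv]
  | succ m ih =>
    rw [nilProd, nilInv, mul_assoc, ← mul_assoc (nilProd _ _ _), ih, one_mul,
      one_add_mul_one_add (by rw [← C_mul, hu.sq, C_0]) (by rw [mul_neg, neg_mul, X_mul_C])]
    simp

end NilProd
section ShiftDet

variable {R : Type*} [CommRing R]

theorem Matrix.sum_det_updateRow_eq_sum_det_updateCol {ι : Type*} [Fintype ι] [DecidableEq ι]
    (M M' : Matrix ι ι R) :
    ∑ i, (M.updateRow i (M' i)).det = ∑ j, (M.updateCol j fun i => M' i j).det := by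
  simp only [Matrix.det_apply]
  rw [Finset.sum_comm, Finset.sum_comm (γ := ι)]
  refine Finset.sum_congr rfl fun σ _ => ?_
  rw [← Equiv.sum_comp σ]
  refine Finset.sum_congr rfl fun j _ => ?_
  congr 1
  refine Finset.prod_congr rfl fun k _ => ?_
  simp only [Matrix.updateRow_apply, Matrix.updateCol_apply, σ.injective.eq_iff]
  split_ifs with hk
  · rw [hk]
  · rfl

/-- The determinant `det (e (α_i - j))`. -/
def shiftDet (e : ℤ → R) {l : ℕ} (α : Fin l → ℤ) : R :=
  (Matrix.of fun i j : Fin l => e (α i - (j : ℕ))).det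

theorem shiftDet_eq_zero_of_eq (e : ℤ → R) {l : ℕ} {α : Fin l → ℤ} {i j : Fin l} (hij : i ≠ j)
    (h : α i = α j) : shiftDet e α = 0 :=
  Matrix.det_zero_of_row_eq hij (by ext k; simp [h])

theorem shiftDet_eq_zero_of_neg {e : ℤ → R} (he : ∀ k < 0, e k = 0) {l : ℕ} {α : Fin l → ℤ}
    {i : Fin l} (h : α i < 0) : shiftDet e α = 0 :=
  Matrix.det_eq_zero_of_row_eq_zero i fun j => he _ (by omega)

theorem shiftDet_id {e : ℤ → R} (he : ∀ k < 0, e k = 0) (he0 : e 0 = 1) (l : ℕ) :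
    shiftDet e (fun i : Fin l => ((i : ℕ) : ℤ)) = 1 := by
  rw [shiftDet, Matrix.det_of_isLowerTriangular]
  · simp [he0]
  · intro i j hij
    exact he _ (by have : i < j := hij; have : (i : ℕ) < j := this; omega)

theorem shiftDet_succ_of_zero {e : ℤ → R} (he : ∀ k < 0, e k = 0) (he0 : e 0 = 1) {l : ℕ}
    {α : Fin (l + 1) → ℤ} (h : α 0 = 0) :
    shiftDet e α = shiftDet e fun i : Fin l => α i.succ - 1 := by
  rw [shiftDet, Matrix.det_succ_row_zero, Fin.sum_univ_succ, Finset.sum_eq_zero]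
  · simp only [Matrix.of_apply, h, Fin.val_zero, Nat.cast_zero, sub_zero, he0, pow_zero, one_mul,
      add_zero, shiftDet]
    congr 1
    ext i j
    simp only [Matrix.submatrix_apply, Matrix.of_apply, Fin.succAbove_zero, Fin.val_succ]
    congr 1
    push_cast
    ring
  · intro j _
    rw [Matrix.of_apply, h, he _ (by simp; omega)]
    simp

/-- A sequence satisfying a monic linear recurrence of order `p` from index `1` on. -/
def IsRecurrent (e : ℤ → R) (p : ℕ) : Prop :=
  ∃ b : ℕ → R, b 0 = 1 ∧ ∀ t : ℤ, 1 ≤ t → ∑ k ∈ Finset.range (p + 1), b k * e (t - k) = 0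

theorem shiftDet_eq_zero_of_isRecurrent {e : ℤ → R} {p : ℕ} (h : IsRecurrent e p)
    {α : Fin (p + 1) → ℤ} (hα : ∀ i, 1 ≤ α i) : shiftDet e α = 0 := by
  obtain ⟨b, hb0, hb⟩ := h
  set M : Matrix (Fin (p + 1)) (Fin (p + 1)) R := Matrix.of fun i j => e (α i - (j : ℕ)) with hM
  have h1 := Matrix.det_updateCol_sum M 0 (fun k => b k)
  have h2 : (fun k => ∑ i : Fin (p + 1), b i • M k i) = fun _ => 0 := by
    ext k
    rw [← hb (α k) (hα k), Finset.sum_range]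
    simp [hM]
  rw [h2] at h1
  simp only [Fin.val_zero, hb0, one_smul] at h1
  rw [shiftDet, ← hM, ← h1]
  exact Matrix.det_eq_zero_of_column_eq_zero 0 (by simp)

/-- The Pieri rule for multiplication by `e 1`. -/
theorem sum_shiftDet_add_single {e : ℤ → R} {p : ℕ} (he : ∀ k < 0, e k = 0) (he0 : e 0 = 1)
    (h : IsRecurrent e (p + 1)) {α : Fin (p + 1) → ℤ} (hα : ∀ i, 0 ≤ α i) :
    ∑ i, shiftDet e (α + Pi.single i 1) = e 1 * shiftDet e α := by
  obtain ⟨b, hb0, hb⟩ := h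
  have hb1 : b 1 = -e 1 := by
    have := hb 1 le_rfl
    rw [Finset.sum_range_succ', Finset.sum_range_succ', Finset.sum_eq_zero] at this
    · simp [hb0, he0] at this
      exact eq_neg_of_add_eq_zero_left this
    · intro k _
      rw [he _ (by push_cast; omega), mul_zero]
  set M : Matrix (Fin (p + 1)) (Fin (p + 1)) R := Matrix.of fun i j => e (α i - (j : ℕ)) with hM
  set M' : Matrix (Fin (p + 1)) (Fin (p + 1)) R :=
    Matrix.of fun i j => e (α i + 1 - (j : ℕ)) with hM'
  have h1 : ∀ i, shiftDet e (α + Pi.single i 1) = (M.updateRow i (M' i)).det := by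
    intro i
    rw [shiftDet]
    congr 1
    ext k j
    rw [Matrix.updateRow_apply]
    split_ifs with hk
    · subst hk; simp [hM']
    · simp [hM, hk]
  rw [Finset.sum_congr rfl fun i _ => h1 i, Matrix.sum_det_updateRow_eq_sum_det_updateCol,
    Fin.sum_univ_succ, Finset.sum_eq_zero, add_zero]
  · have h2 := Matrix.det_updateCol_sum M 0 (fun k => -b (k + 1))
    have h3 : (fun k => ∑ i : Fin (p + 1), -b (i + 1) • M k i) = fun i => M' i 0 := by
      ext k
      have := hb (α k + 1) (by have := hα k; omega)
      rw [Finset.sum_range_succ', hb0, Finset.sum_range] at this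
      simp only [hM', Matrix.of_apply, hM, smul_eq_mul, neg_mul, Finset.sum_neg_distrib]
      rw [neg_eq_iff_add_eq_zero]
      simpa [add_sub_add_right_eq_sub] using this
    rw [h3] at h2
    rw [h2, Fin.val_zero, zero_add, hb1, neg_neg, smul_eq_mul, shiftDet]
  · intro j _
    refine Matrix.det_zero_of_column_eq (i := j.succ) (j := j.castSucc)
      (Fin.castSucc_lt_succ).ne' fun k => ?_
    rw [Matrix.updateCol_self, Matrix.updateCol_ne (Fin.castSucc_lt_succ).ne]
    simp [hM, hM']

end ShiftDet

/-- Integer-valued functions on words, a word being the sequence of its values. -/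
abbrev WordFun := (ℕ → ℕ) → ℤ

/-- The operator of right multiplication by the `i`-th adjacent transposition at an ascent. -/
def ascentOp (i : ℕ) : Module.End ℤ WordFun where
  toFun f w := if w i < w (i + 1) then f (w ∘ Equiv.swap i (i + 1)) else 0
  map_add' f g := by ext w; dsimp; split_ifs <;> simp
  map_smul' c f := by ext w; dsimp; split_ifs <;> simp

theorem ascentOp_apply (i : ℕ) (f : WordFun) (w : ℕ → ℕ) :
    ascentOp i f w = if w i < w (i + 1) then f (w ∘ Equiv.swap i (i + 1)) else 0 := rfl

theorem isNilCoxeter_ascentOp : IsNilCoxeter ascentOp where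
  sq i := by
    ext f w
    simp only [Module.End.mul_apply, ascentOp_apply, Function.comp_apply, Equiv.swap_apply_left,
      Equiv.swap_apply_right, LinearMap.zero_apply, Pi.zero_apply]
    split_ifs
    · omega
    · rfl
    · rfl
  braid i := by
    ext f w
    have h1 : Equiv.swap i (i + 1) (i + 2) = i + 2 :=
      Equiv.swap_apply_of_ne_of_ne (by omega) (by omega)
    have h2 : Equiv.swap (i + 1) (i + 2) i = i :=
      Equiv.swap_apply_of_ne_of_ne (by omega) (by omega)
    have h3 : (⇑(Equiv.swap i (i + 1)) ∘ ⇑(Equiv.swap (i + 1) (i + 2))) ∘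
        ⇑(Equiv.swap i (i + 1)) = (⇑(Equiv.swap (i + 1) (i + 2)) ∘ ⇑(Equiv.swap i (i + 1))) ∘
          ⇑(Equiv.swap (i + 1) (i + 2)) := by
      ext k
      simp only [Function.comp_apply, Equiv.swap_apply_def]
      split_ifs <;> omega
    simp only [Module.End.mul_apply, ascentOp_apply, Function.comp_apply, Equiv.swap_apply_left,
      Equiv.swap_apply_right, add_assoc, Nat.reduceAdd, h1, h2]
    simp only [Function.comp_assoc] at h3 ⊢
    rw [h3]
    split_ifs <;> rfl
  comm i j hij := by
    ext f w
    have h1 : Equiv.swap i (i + 1) j = j := Equiv.swap_apply_of_ne_of_ne (by omega) (by omega)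
    have h2 : Equiv.swap i (i + 1) (j + 1) = j + 1 :=
      Equiv.swap_apply_of_ne_of_ne (by omega) (by omega)
    have h3 : Equiv.swap j (j + 1) i = i := Equiv.swap_apply_of_ne_of_ne (by omega) (by omega)
    have h4 : Equiv.swap j (j + 1) (i + 1) = i + 1 :=
      Equiv.swap_apply_of_ne_of_ne (by omega) (by omega)
    have h5 : ⇑(Equiv.swap i (i + 1)) ∘ ⇑(Equiv.swap j (j + 1)) =
        ⇑(Equiv.swap j (j + 1)) ∘ ⇑(Equiv.swap i (i + 1)) := by
      ext k
      simp only [Function.comp_apply, Equiv.swap_apply_def]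
      split_ifs <;> omega
    simp only [Module.End.mul_apply, ascentOp_apply, Function.comp_apply, h1, h2, h3, h4,
      Function.comp_assoc, h5]
    split_ifs <;> rfl

/-- Insert a new smallest value at position `k`. -/
def insertMin (k : ℕ) (v : ℕ → ℕ) (i : ℕ) : ℕ :=
  if i < k then v i + 1 else if i = k then 0 else v (i - 1) + 1

/-- The operator of precomposition with `insertMin`. -/
def insertMinOp (k : ℕ) : Module.End ℤ WordFun where
  toFun f v := f (insertMin k v)
  map_add' _ _ := rfl
  map_smul' _ _ := rfl

theorem insertMinOp_apply (k : ℕ) (f : WordFun) (v : ℕ → ℕ) :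
    insertMinOp k f v = f (insertMin k v) := rfl

theorem insertMinOp_mul_ascentOp_of_lt {k i : ℕ} (h : i + 1 < k) :
    insertMinOp k * ascentOp i = ascentOp i * insertMinOp k := by
  ext f v
  have h1 : insertMin k v ∘ Equiv.swap i (i + 1) = insertMin k (v ∘ Equiv.swap i (i + 1)) := by
    ext j
    simp only [Function.comp_apply, Equiv.swap_apply_def, insertMin]
    grind
  simp only [Module.End.mul_apply, ascentOp_apply, insertMinOp_apply, h1]
  simp [insertMin, h, show i < k by omega]

theorem insertMinOp_mul_ascentOp_of_gt {k i : ℕ} (h : k ≤ i) :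
    insertMinOp k * ascentOp (i + 1) = ascentOp i * insertMinOp k := by
  ext f v
  have h1 : insertMin k v ∘ Equiv.swap (i + 1) (i + 1 + 1) =
      insertMin k (v ∘ Equiv.swap i (i + 1)) := by
    ext j
    simp only [Function.comp_apply, Equiv.swap_apply_def, insertMin]
    grind
  simp only [Module.End.mul_apply, ascentOp_apply, insertMinOp_apply, h1]
  congr 1
  simp only [insertMin]
  grind

theorem insertMinOp_mul_ascentOp_self (k : ℕ) :
    insertMinOp k * ascentOp k = insertMinOp (k + 1) := by
  ext f v
  have h1 : insertMin k v ∘ Equiv.swap k (k + 1) = insertMin (k + 1) v := by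
    ext j
    simp only [Function.comp_apply, Equiv.swap_apply_def, insertMin]
    grind
  simp only [Module.End.mul_apply, ascentOp_apply, insertMinOp_apply, h1]
  simp [insertMin]

theorem insertMinOp_succ_mul_ascentOp (k : ℕ) : insertMinOp (k + 1) * ascentOp k = 0 := by
  ext f v
  simp [ascentOp_apply, insertMinOp_apply, insertMin]

theorem exists_C_insertMinOp_mul_nilProd_of_le {m k : ℕ} (hmk : m ≤ k) :
    ∃ c : (Module.End ℤ WordFun)[X],
      C (insertMinOp k) * nilProd (fun i => C (ascentOp i)) X m = c * C (insertMinOp k) := by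
  have hlt : ∀ m < k, C (insertMinOp k) * nilProd (fun i => C (ascentOp i)) X m =
      nilProd (fun i => C (ascentOp i)) X m * C (insertMinOp k) := fun m hm =>
    commute_nilProd_of_le (X_mul_C _).symm fun i hi => by
      rw [← C_mul, ← C_mul, insertMinOp_mul_ascentOp_of_lt (by omega)]
  rcases hmk.lt_or_eq with h | rfl
  · exact ⟨_, hlt m h⟩
  · cases m with
    | zero => exact ⟨1, by simp [nilProd]⟩
    | succ m =>
      refine ⟨nilProd (fun i => C (ascentOp i)) X m, ?_⟩
      rw [nilProd, ← mul_assoc, mul_add, ← mul_assoc, ← X_mul_C, mul_assoc X, ← C_mul,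
        insertMinOp_succ_mul_ascentOp, C_0, mul_zero, add_zero, mul_one, hlt m (by omega)]

theorem exists_C_insertMinOp_mul_nilProd {m k : ℕ} (hkm : k ≤ m) :
    ∃ c : (Module.End ℤ WordFun)[X],
      C (insertMinOp k) * nilProd (fun i => C (ascentOp i)) X (m + 1) =
        X * nilProd (fun i => C (ascentOp i)) X m * C (insertMinOp (k + 1)) +
          c * C (insertMinOp k) := by
  induction m, hkm using Nat.le_induction with
  | base =>
    obtain ⟨c, hc⟩ := exists_C_insertMinOp_mul_nilProd_of_le (le_refl k)
    refine ⟨c, ?_⟩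
    have h : C (insertMinOp (k + 1)) * nilProd (fun i => C (ascentOp i)) X k =
        nilProd (fun i => C (ascentOp i)) X k * C (insertMinOp (k + 1)) :=
      commute_nilProd_of_le (X_mul_C _).symm fun i hi => by
        rw [← C_mul, ← C_mul, insertMinOp_mul_ascentOp_of_lt (by omega)]
    rw [nilProd, ← mul_assoc, mul_add, ← mul_assoc, ← X_mul_C, mul_assoc X, ← C_mul,
      insertMinOp_mul_ascentOp_self, mul_one, add_mul, hc, mul_assoc X, h, mul_assoc X, add_comm]
  | succ m hkm ih =>
    obtain ⟨c, hc⟩ := ih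
    refine ⟨(1 + X * C (ascentOp m)) * c, ?_⟩
    have h : C (insertMinOp k) * (1 + X * C (ascentOp (m + 1))) =
        (1 + X * C (ascentOp m)) * C (insertMinOp k) := by
      rw [mul_add, ← mul_assoc, ← X_mul_C, mul_assoc X, ← C_mul,
        insertMinOp_mul_ascentOp_of_gt hkm, C_mul, add_mul, mul_assoc X]
      simp
    rw [nilProd, ← mul_assoc, h, mul_assoc, hc, mul_add, nilProd]
    have h2 : (1 + X * C (ascentOp m)) * X = X * (1 + X * C (ascentOp m)) :=
      (X_mul).symm
    simp only [← mul_assoc, h2]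

/-- The word of the longest permutation of `{0,…,m}`. -/
def revWord : ℕ → ℕ → ℕ
  | 0 => id
  | m + 1 => insertMin (m + 1) (revWord m)

theorem revWord_apply (m i : ℕ) : revWord m i = if i ≤ m then m - i else i := by
  induction m generalizing i with
  | zero => simp only [revWord, id]; split_ifs <;> omega
  | succ m ih => simp only [revWord, insertMin, ih]; grind

open Classical in
/-- The indicator function of `revWord m`. -/
noncomputable def revIndicator (m : ℕ) : WordFun := fun w =>
  if w = revWord m then 1 else 0

theorem insertMin_injective (k : ℕ) : Function.Injective (insertMin k) := by
  intro v w h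
  ext i
  rcases lt_or_ge i k with hi | hi
  · have := congrFun h i
    simpa [insertMin, hi] using this
  · have := congrFun h (i + 1)
    simpa [insertMin, show ¬ i + 1 < k by omega, show i + 1 ≠ k by omega] using this

theorem insertMinOp_revIndicator_self (m : ℕ) :
    insertMinOp (m + 1) (revIndicator (m + 1)) = revIndicator m := by
  ext v
  simp only [insertMinOp_apply, revIndicator, revWord]
  congr 1
  exact propext (insertMin_injective (m + 1)).eq_iff

theorem insertMinOp_revIndicator_of_ne {m k : ℕ} (hk : k ≠ m + 1) :
    insertMinOp k (revIndicator (m + 1)) = 0 := by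
  ext v
  rw [insertMinOp_apply, revIndicator, if_neg, Pi.zero_apply]
  intro h
  have := congrFun h k
  simp only [insertMin, lt_self_iff_false, if_false, if_true, revWord_apply] at this
  split_ifs at this <;> omega

theorem exists_insertMinOp_mul_nilElem {m k : ℕ} (hkm : k ≤ m) (a : ℤ) :
    ∃ c : Module.End ℤ WordFun, insertMinOp k * nilElem ascentOp (m + 1) a =
      nilElem ascentOp m (a - 1) * insertMinOp (k + 1) + c * insertMinOp k := by
  obtain ⟨c, hc⟩ := exists_C_insertMinOp_mul_nilProd hkm
  rcases lt_or_ge a 0 with ha | ha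
  · exact ⟨0, by simp [nilElem_of_neg _ _ ha, nilElem_of_neg _ _ (show a - 1 < 0 by omega)]⟩
  lift a to ℕ using ha
  refine ⟨c.coeff a, ?_⟩
  have h := congrArg (fun p => p.coeff a) hc
  simp only [Polynomial.coeff_add, Polynomial.coeff_C_mul, Polynomial.coeff_mul_C] at h
  rw [nilElem_natCast, h]
  congr 2
  cases a with
  | zero => simp [nilElem]
  | succ a =>
    rw [Polynomial.coeff_X_mul, Nat.cast_succ, add_sub_cancel_right, nilElem_natCast]

theorem insertMinOp_prod_nilElem_apply {m k : ℕ} (L : List ℤ) (f : WordFun)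
    (hk : k + L.length ≤ m + 1) (hf : ∀ j < k + L.length, insertMinOp j f = 0) :
    insertMinOp k ((L.map (nilElem ascentOp (m + 1))).prod f) =
      (L.map fun a => nilElem ascentOp m (a - 1)).prod (insertMinOp (k + L.length) f) := by
  induction L generalizing k with
  | nil => simp
  | cons a L ih =>
    rw [List.length_cons] at hk hf
    obtain ⟨c, hc⟩ := exists_insertMinOp_mul_nilElem (show k ≤ m by omega) a
    have h1 := ih (k := k + 1) (by omega) fun j hj => hf j (by omega)
    have h2 := ih (k := k) (by omega) fun j hj => hf j (by omega)
    rw [hf (k + L.length) (by omega), map_zero] at h2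
    rw [List.map_cons, List.prod_cons, Module.End.mul_apply, ← Module.End.mul_apply, hc,
      LinearMap.add_apply, Module.End.mul_apply, Module.End.mul_apply, h1, h2, map_zero, add_zero,
      List.map_cons, List.prod_cons, Module.End.mul_apply, List.length_cons,
      show k + 1 + L.length = k + (L.length + 1) by omega]

/-- The coefficient of the longest permutation of `{0,…,m}`. -/
noncomputable def revCoeff (m : ℕ) : Module.End ℤ WordFun →+ ℤ where
  toFun r := r (revIndicator m) id
  map_zero' := rfl
  map_add' _ _ := rfl

theorem revCoeff_apply (m : ℕ) (r : Module.End ℤ WordFun) :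
    revCoeff m r = r (revIndicator m) id := rfl

theorem revCoeff_prod_nilElem (m : ℕ) (a : Fin (m + 1) → ℤ) :
    revCoeff (m + 1) (List.ofFn fun i => nilElem ascentOp (m + 1) (a i)).prod =
      revCoeff m (List.ofFn fun i => nilElem ascentOp m (a i - 1)).prod := by
  have h := insertMinOp_prod_nilElem_apply (m := m) (k := 0) (List.ofFn a) (revIndicator (m + 1))
    (by simp) (fun j hj => insertMinOp_revIndicator_of_ne (by simp at hj; omega))
  rw [List.map_ofFn, List.map_ofFn, List.length_ofFn, zero_add, insertMinOp_revIndicator_self] at h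
  have h0 : insertMin 0 id = id := by ext i; simp [insertMin]; split_ifs <;> omega
  have := congrFun h id
  rw [insertMinOp_apply, h0] at this
  exact this

/-- A commutative ring containing copies of the elements `nilElem u m k`. -/
structure NilElemModel {Q : Type*} [Ring Q] (u : ℕ → Q) (m : ℕ) {R : Type*} [CommRing R]
    (f : R →+* Q) (e : ℤ → R) : Prop where
  map_eq : ∀ k, f (e k) = nilElem u m k
  of_neg : ∀ k < 0, e k = 0
  zero : e 0 = 1
  isRecurrent : IsRecurrent e m

theorem IsNilCoxeter.nilInv_coeff_mem {Q : Type*} [Ring Q] {u : ℕ → Q} (hu : IsNilCoxeter u)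
    (m t : ℕ) : (nilInv u m).coeff t ∈ Algebra.adjoin ℤ (Set.range (nilElem u m)) := by
  induction t using Nat.strong_induction_on with
  | _ t ih =>
    have h := congrArg (fun p => p.coeff t) (hu.nilProd_mul_nilInv m)
    simp only [Polynomial.coeff_mul, Finset.Nat.sum_antidiagonal_eq_sum_range_succ_mk] at h
    rw [Finset.sum_range_succ', nilProd_coeff_zero, one_mul, tsub_zero] at h
    rw [eq_sub_of_add_eq' h]
    refine sub_mem ?_ (sum_mem fun k hk => mul_mem ?_ (ih _ ?_))
    · rw [Polynomial.coeff_one]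
      split_ifs
      · exact one_mem _
      · exact zero_mem _
    · exact Algebra.subset_adjoin ⟨_, nilElem_natCast u m (k + 1)⟩
    · rw [Finset.mem_range] at hk; omega

open scoped IsMulCommutative in
theorem IsNilCoxeter.exists_nilElemModel {Q : Type} [Ring Q] {u : ℕ → Q} (hu : IsNilCoxeter u)
    (m : ℕ) : ∃ (R : Type) (_ : CommRing R) (f : R →+* Q) (e : ℤ → R), NilElemModel u m f e := by
  have hcomm : ∀ a ∈ Set.range (nilElem u m), ∀ b ∈ Set.range (nilElem u m), a * b = b * a := by
    rintro _ ⟨j, rfl⟩ _ ⟨k, rfl⟩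
    exact hu.nilElem_comm m j k
  set S := Algebra.adjoin ℤ (Set.range (nilElem u m)) with hS
  have : IsMulCommutative S := Algebra.isMulCommutative_adjoin ℤ hcomm
  let f : S →+* Q := S.val.toRingHom
  have hf : Function.Injective f := Subtype.val_injective
  let e : ℤ → S := fun k => ⟨nilElem u m k, Algebra.subset_adjoin ⟨k, rfl⟩⟩
  have he (k) : f (e k) = nilElem u m k := rfl
  have hneg : ∀ k < 0, e k = 0 := fun k hk => hf (by rw [he, nilElem_of_neg u m hk, map_zero])
  refine ⟨S, inferInstance, f, e, he, hneg, hf (by rw [he, nilElem_zero, map_one]),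
    fun k => ⟨(nilInv u m).coeff k, hu.nilInv_coeff_mem m k⟩, hf ?_, fun t ht => hf ?_⟩
  · have h := congrArg (fun p => p.coeff 0) (hu.nilProd_mul_nilInv m)
    simp only [Polynomial.mul_coeff_zero, nilProd_coeff_zero, Polynomial.coeff_one_zero,
      one_mul] at h
    rw [map_one]
    exact h
  · lift t to ℕ using by omega
    have h := congrArg (fun p => p.coeff t) (hu.nilProd_mul_nilInv m)
    rw [Polynomial.coeff_mul, ← Finset.Nat.sum_antidiagonal_swap,
      Finset.Nat.sum_antidiagonal_eq_sum_range_succ_mk, Polynomial.coeff_one,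
      if_neg (by omega)] at h
    rw [map_zero, ← h, map_sum]
    have h1 : ∀ k ≤ t, nilElem u m ((t : ℤ) - k) =
        (nilProd (fun i => Polynomial.C (u i)) Polynomial.X m).coeff (t - k) := fun k hk => by
      rw [← nilElem_natCast, Nat.cast_sub hk]
    have h2 : ∀ n, ∑ k ∈ Finset.range n, f (⟨(nilInv u m).coeff k, hu.nilInv_coeff_mem m k⟩ *
        e (t - k)) = ∑ k ∈ Finset.range n, nilElem u m (t - k) * (nilInv u m).coeff k := fun n =>
      Finset.sum_congr rfl fun k _ => by rw [mul_comm, map_mul]; rfl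
    rw [h2]
    trans ∑ k ∈ Finset.range (t + m + 1), nilElem u m (t - k) * (nilInv u m).coeff k
    · refine Finset.sum_subset (Finset.range_mono (by omega)) fun k _ hk => ?_
      rw [Finset.mem_range] at hk
      rw [Polynomial.coeff_eq_zero_of_natDegree_lt
        ((natDegree_nilInv_le u m).trans_lt (by omega)), mul_zero]
    · symm
      rw [← Finset.sum_subset (Finset.range_mono (show t + 1 ≤ t + m + 1 by omega))]
      · refine Finset.sum_congr rfl fun k hk => ?_
        rw [h1 k (by rw [Finset.mem_range] at hk; omega)]
        rfl
      · intro k _ hk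
        rw [Finset.mem_range] at hk
        rw [nilElem_of_neg u m (by omega), zero_mul]

theorem NilElemModel.map_shiftDet {Q : Type*} [Ring Q] {u : ℕ → Q} {m : ℕ} {R : Type*}
    [CommRing R] {f : R →+* Q} {e : ℤ → R} (h : NilElemModel u m f e) {l : ℕ} (α : Fin l → ℤ) :
    f (shiftDet e α) = ∑ σ : Equiv.Perm (Fin l), Equiv.Perm.sign σ •
      (List.ofFn fun i : Fin l => nilElem u m (α (σ i) - (i : ℕ))).prod := by
  rw [shiftDet, Matrix.det_apply, map_sum]
  refine Finset.sum_congr rfl fun σ _ => ?_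
  rw [Units.smul_def, Units.smul_def, map_zsmul]
  congr 1
  simp only [Matrix.of_apply]
  rw [← List.prod_ofFn, map_list_prod, List.map_ofFn]
  congr 2
  funext i
  exact h.map_eq _

theorem revCoeff_shiftDet {m : ℕ} {R : Type} [CommRing R] {f : R →+* Module.End ℤ WordFun}
    {e : ℤ → R} (h : NilElemModel ascentOp m f e) {α : Fin m → ℤ} (hα : StrictMono α)
    (hα0 : ∀ i, 0 ≤ α i) :
    revCoeff m (f (shiftDet e α)) = if ∀ i, α i = 2 * ((i : ℕ) : ℤ) + 1 then 1 else 0 := by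
  induction m generalizing R with
  | zero =>
    have : shiftDet e α = 1 := Matrix.det_isEmpty
    rw [this, map_one, if_pos (fun i => i.elim0), revCoeff_apply, Module.End.one_apply,
      revIndicator, revWord, if_pos rfl]
  | succ m ih =>
    obtain ⟨R', _, f', e', h'⟩ := isNilCoxeter_ascentOp.exists_nilElemModel m
    have h1 : revCoeff (m + 1) (f (shiftDet e α)) =
        revCoeff m (f' (shiftDet e' fun i => α i - 1)) := by
      rw [h.map_shiftDet, h'.map_shiftDet, map_sum, map_sum]
      refine Finset.sum_congr rfl fun σ _ => ?_
      rw [Units.smul_def, Units.smul_def, map_zsmul, map_zsmul, revCoeff_prod_nilElem]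
      simp only [sub_right_comm]
    rw [h1]
    rcases lt_trichotomy (α 0) 1 with h0 | h0 | h0
    · rw [shiftDet_eq_zero_of_neg h'.of_neg (i := 0) (by omega), map_zero, map_zero, if_neg]
      intro hc
      have := hc 0
      simp at this
      omega
    · have hpos (i : Fin m) : 2 ≤ α i.succ := by
        have := hα (Fin.succ_pos i); omega
      rw [shiftDet_succ_of_zero h'.of_neg h'.zero (by omega), ih h' ?_ ?_]
      · refine if_congr ?_ rfl rfl
        rw [Fin.forall_fin_succ]
        simp only [h0, Fin.val_zero, Fin.val_succ]
        push_cast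
        constructor
        · exact fun hc => ⟨by norm_num, fun i => by have := hc i; omega⟩
        · exact fun hc i => by have := hc.2 i; omega
      · intro i j hij
        have := hα (Fin.succ_lt_succ_iff.2 hij)
        dsimp only
        omega
      · intro i
        have := hpos i
        omega
    · have hpos (i : Fin (m + 1)) : 1 ≤ α i - 1 := by
        have := hα.monotone (Fin.zero_le i); omega
      rw [shiftDet_eq_zero_of_isRecurrent h'.isRecurrent hpos, map_zero, map_zero, if_neg]
      intro hc
      have := hc 0
      simp at this
      omega

section Paths

variable {X ι : Type*} (ok : X → ι → Prop) (step : X → ι → X) (target : X → Prop)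

/-- The word `v` labels a path of admissible steps from `x` to the target. -/
def IsPath : (k : ℕ) → X → (Fin k → ι) → Prop
  | 0, x, _ => target x
  | k + 1, x, v => ok x (v 0) ∧ IsPath k (step x (v 0)) (Fin.tail v)

open Classical in
theorem card_isPath_zero (x : X) :
    Nat.card {v : Fin 0 → ι // IsPath ok step target 0 x v} = if target x then 1 else 0 := by
  simp only [IsPath]
  split_ifs with h
  · simp [h]
  · simp [h]

open Classical in
theorem card_isPath_succ [Fintype ι] (k : ℕ) (x : X) :
    Nat.card {v : Fin (k + 1) → ι // IsPath ok step target (k + 1) x v} =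
      ∑ i, if ok x i then Nat.card {v : Fin k → ι // IsPath ok step target k (step x i) v}
        else 0 := by
  have h1 : {v : Fin (k + 1) → ι // IsPath ok step target (k + 1) x v} ≃
      Σ i, {v : Fin k → ι // ok x i ∧ IsPath ok step target k (step x i) v} :=
    { toFun := fun v => ⟨v.1 0, Fin.tail v.1, v.2⟩
      invFun := fun p => ⟨Fin.cons p.1 p.2.1, by simpa [IsPath] using p.2.2⟩
      left_inv := fun v => by simp
      right_inv := fun p => rfl }
  rw [Nat.card_congr h1, Nat.card_sigma]
  refine Finset.sum_congr rfl fun i _ => ?_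
  split_ifs with h <;> simp [h]

end Paths

section Words

variable {m : ℕ}

/-- The pairs of positions in inverse order. -/
def invSet {n : ℕ} (g : Equiv.Perm (Fin n)) : Finset (Fin n × Fin n) :=
  Finset.univ.filter fun p => p.1 < p.2 ∧ g p.2 < g p.1

theorem mem_invSet {n : ℕ} {g : Equiv.Perm (Fin n)} {a b : Fin n} :
    (a, b) ∈ invSet g ↔ a < b ∧ g b < g a := by
  simp [invSet]

theorem mul_adjTransposition_apply (g : Equiv.Perm (Fin (m + 1))) (i : Fin m) (k : Fin (m + 1)) :
    (g * adjTransposition (n := m + 1) i) k = g (Equiv.swap i.castSucc i.succ k) := rfl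

theorem card_invSet_mul_of_lt {g : Equiv.Perm (Fin (m + 1))} {i : Fin m}
    (h : g i.castSucc < g i.succ) :
    (invSet (g * adjTransposition (n := m + 1) i)).card = (invSet g).card + 1 := by
  have hswap : ∀ c d : Fin (m + 1), c < d → (c, d) ≠ (i.castSucc, i.succ) →
      Equiv.swap i.castSucc i.succ c < Equiv.swap i.castSucc i.succ d := by
    intro c d hcd hne
    rw [Ne, Prod.mk.injEq] at hne
    simp only [Equiv.swap_apply_def]
    simp only [Fin.ext_iff, Fin.lt_def, Fin.val_castSucc, Fin.val_succ] at *
    split_ifs <;> (try simp only [Fin.val_castSucc, Fin.val_succ]) <;> omega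
  have hnot : (i.castSucc, i.succ) ∉ (invSet g).map
      (Equiv.prodCongr (Equiv.swap i.castSucc i.succ)
        (Equiv.swap i.castSucc i.succ)).toEmbedding := by
    intro hmem
    rw [Finset.mem_map_equiv] at hmem
    have hmem' : (Equiv.swap i.castSucc i.succ i.castSucc,
      Equiv.swap i.castSucc i.succ i.succ) ∈ invSet g := hmem
    rw [Equiv.swap_apply_left, Equiv.swap_apply_right, mem_invSet] at hmem'
    exact absurd hmem'.1 (Fin.castSucc_lt_succ).not_gt
  have key : invSet (g * adjTransposition (n := m + 1) i) =
      Finset.cons (i.castSucc, i.succ) _ hnot := by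
    ext ⟨a, b⟩
    rw [Finset.mem_cons, Finset.mem_map_equiv, mem_invSet, mul_adjTransposition_apply,
      mul_adjTransposition_apply]
    change _ ↔ _ ∨ (Equiv.swap i.castSucc i.succ a, Equiv.swap i.castSucc i.succ b) ∈ invSet g
    rw [mem_invSet]
    constructor
    · rintro ⟨hab, hg⟩
      by_cases hne : (a, b) = (i.castSucc, i.succ)
      · exact Or.inl hne
      · exact Or.inr ⟨hswap a b hab hne, hg⟩
    · rintro (hab | ⟨hab, hg⟩)
      · rw [Prod.mk.injEq] at hab
        rw [hab.1, hab.2, Equiv.swap_apply_left, Equiv.swap_apply_right]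
        exact ⟨Fin.castSucc_lt_succ, h⟩
      · refine ⟨?_, hg⟩
        have := hswap _ _ hab ?_
        · simpa using this
        · intro hne
          rw [Prod.mk.injEq] at hne
          rw [hne.1, hne.2] at hg
          exact absurd hg h.not_gt
  rw [key, Finset.card_cons, Finset.card_map]

theorem card_invSet_mul_of_gt {g : Equiv.Perm (Fin (m + 1))} {i : Fin m}
    (h : g i.succ < g i.castSucc) :
    (invSet (g * adjTransposition (n := m + 1) i)).card + 1 = (invSet g).card := by
  have h1 := card_invSet_mul_of_lt (g := g * adjTransposition (n := m + 1) i) (i := i)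
    (by simpa [mul_adjTransposition_apply] using h)
  have h2 : adjTransposition (n := m + 1) i * adjTransposition (n := m + 1) i = 1 :=
    Equiv.swap_mul_self _ _
  rw [← h1, mul_assoc, h2, mul_one]

theorem card_invSet_mul_le (g : Equiv.Perm (Fin (m + 1))) (i : Fin m) :
    (invSet (g * adjTransposition (n := m + 1) i)).card ≤ (invSet g).card + 1 := by
  rcases lt_trichotomy (g i.castSucc) (g i.succ) with h | h | h
  · exact (card_invSet_mul_of_lt h).le
  · exact absurd (g.injective h) (Fin.castSucc_lt_succ).ne
  · have := card_invSet_mul_of_gt h; omega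

/-- The product of the adjacent transpositions indexed by a word. -/
def wordProd {k : ℕ} (v : Fin k → Fin m) : Equiv.Perm (Fin (m + 1)) :=
  (List.ofFn fun j => adjTransposition (n := m + 1) (v j)).prod

theorem wordProd_zero (v : Fin 0 → Fin m) : wordProd v = 1 := by simp [wordProd]

theorem wordProd_succ {k : ℕ} (v : Fin (k + 1) → Fin m) :
    wordProd v = adjTransposition (n := m + 1) (v 0) * wordProd (Fin.tail v) := by
  rw [wordProd, List.ofFn_succ, List.prod_cons]
  rfl

theorem card_invSet_mul_wordProd_le {k : ℕ} (v : Fin k → Fin m) (g : Equiv.Perm (Fin (m + 1))) :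
    (invSet (g * wordProd v)).card ≤ (invSet g).card + k := by
  induction k generalizing g with
  | zero => simp [wordProd_zero]
  | succ k ih =>
    rw [wordProd_succ, ← mul_assoc]
    have h1 := ih (Fin.tail v) (g * adjTransposition (n := m + 1) (v 0))
    have h2 := card_invSet_mul_le g (v 0)
    omega

theorem card_invSet_one : (invSet (1 : Equiv.Perm (Fin (m + 1)))).card = 0 := by
  simp only [invSet, Finset.card_eq_zero, Finset.filter_eq_empty_iff]
  intro p _ h
  exact absurd h.1 h.2.not_gt

theorem card_invSet_revPerm :
    (invSet (Fin.revPerm : Equiv.Perm (Fin (m + 1)))).card = (m + 1) * m / 2 := by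
  have h : invSet (Fin.revPerm : Equiv.Perm (Fin (m + 1))) =
      Finset.univ.filter fun p : Fin (m + 1) × Fin (m + 1) => p.1 < p.2 := by
    ext p; simp [invSet]
  rw [h, Finset.card_filter, Fintype.sum_prod_type_right]
  have (b : Fin (m + 1)) : ∑ a : Fin (m + 1), (if a < b then 1 else 0) = (b : ℕ) := by
    rw [← Finset.card_filter, Finset.filter_gt_eq_Iio, Fin.card_Iio]
  rw [Finset.sum_congr rfl fun b _ => this b, ← Finset.sum_range fun b => b,
    Finset.sum_range_id, Nat.add_sub_cancel]

theorem isPath_iff_mul_wordProd_eq {k : ℕ} {g h : Equiv.Perm (Fin (m + 1))}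
    (hg : (invSet g).card + k = (invSet h).card) (v : Fin k → Fin m) :
    IsPath (fun g (i : Fin m) => g i.castSucc < g i.succ)
      (fun g i => g * adjTransposition (n := m + 1) i) (fun g => g = h) k g v ↔
        g * wordProd v = h := by
  induction k generalizing g with
  | zero => simp [IsPath, wordProd_zero]
  | succ k ih =>
    rw [IsPath, wordProd_succ, ← mul_assoc]
    constructor
    · rintro ⟨hlt, hp⟩
      have := card_invSet_mul_of_lt hlt
      exact (ih (by omega) _).1 hp
    · intro heq
      have h1 := card_invSet_mul_wordProd_le (Fin.tail v)
        (g * adjTransposition (n := m + 1) (v 0))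
      rw [heq] at h1
      have hlt : g (v 0).castSucc < g (v 0).succ := by
        rcases lt_trichotomy (g (v 0).castSucc) (g (v 0).succ) with h2 | h2 | h2
        · exact h2
        · exact absurd (g.injective h2) (Fin.castSucc_lt_succ).ne
        · have := card_invSet_mul_of_gt h2; omega
      have := card_invSet_mul_of_lt hlt
      exact ⟨hlt, (ih (by omega) _).2 heq⟩

/-- The sequence of values of a permutation. -/
def permWord (g : Equiv.Perm (Fin (m + 1))) (i : ℕ) : ℕ :=
  if h : i < m + 1 then g ⟨i, h⟩ else i

theorem permWord_val (g : Equiv.Perm (Fin (m + 1))) (i : Fin (m + 1)) : permWord g i = g i :=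
  dif_pos i.isLt

theorem permWord_mul (g h : Equiv.Perm (Fin (m + 1))) :
    permWord (g * h) = permWord g ∘ permWord h := by
  ext i
  by_cases hi : i < m + 1
  · rw [Function.comp_apply, permWord, permWord, permWord, dif_pos hi, dif_pos hi,
      dif_pos (Fin.isLt _)]
    rfl
  · simp [permWord, hi]

theorem permWord_adjTransposition (i : Fin m) :
    permWord (adjTransposition (n := m + 1) i) = Equiv.swap (i : ℕ) (i + 1) := by
  ext k
  have hi := i.isLt
  simp only [permWord, adjTransposition, Equiv.swap_apply_def, Fin.ext_iff]
  split_ifs <;> simp_all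

theorem permWord_eq_revWord_iff (g : Equiv.Perm (Fin (m + 1))) :
    permWord g = revWord m ↔ g = Fin.revPerm := by
  constructor
  · intro h
    ext i
    have := congrFun h i
    rw [permWord_val, revWord_apply, if_pos (Nat.lt_succ_iff.1 i.isLt)] at this
    rw [this, Fin.revPerm_apply, Fin.val_rev]
    omega
  · rintro rfl
    ext i
    simp only [permWord, revWord_apply, Fin.revPerm_apply, Fin.val_rev]
    split_ifs <;> omega

theorem nilElem_one_pow_revIndicator (k : ℕ) (g : Equiv.Perm (Fin (m + 1))) :
    (nilElem ascentOp m 1 ^ k) (revIndicator m) (permWord g) =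
      Nat.card {v : Fin k → Fin m // IsPath (fun g (i : Fin m) => g i.castSucc < g i.succ)
        (fun g i => g * adjTransposition (n := m + 1) i) (fun g => g = Fin.revPerm) k g v} := by
  induction k generalizing g with
  | zero =>
    rw [card_isPath_zero, pow_zero, Module.End.one_apply, revIndicator]
    simp only [permWord_eq_revWord_iff, Nat.cast_ite, Nat.cast_one, Nat.cast_zero]
  | succ k ih =>
    rw [card_isPath_succ, pow_succ', Module.End.mul_apply, nilElem_one, LinearMap.sum_apply,
      Finset.sum_apply, Finset.sum_range, Nat.cast_sum]
    refine Finset.sum_congr rfl fun i _ => ?_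
    rw [ascentOp_apply, ← permWord_adjTransposition, ← permWord_mul, ← nilElem_one, ih]
    have h1 := permWord_val g i.castSucc
    have h2 := permWord_val g i.succ
    rw [Fin.val_castSucc] at h1
    rw [Fin.val_succ] at h2
    rw [h1, h2]
    simp only [Fin.val_fin_lt, Nat.cast_ite, Nat.cast_zero]

theorem revCoeff_nilElem_one_pow (m : ℕ) :
    revCoeff m (nilElem ascentOp m 1 ^ ((m + 1) * m / 2)) =
      Nat.card {v : Fin ((m + 1) * m / 2) → Fin m // wordProd v = Fin.revPerm} := by
  have h1 : permWord (1 : Equiv.Perm (Fin (m + 1))) = id := by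
    ext i; simp [permWord]
  rw [revCoeff_apply, ← h1, nilElem_one_pow_revIndicator]
  congr 1
  refine Nat.card_congr (Equiv.subtypeEquivRight fun v => ?_)
  rw [isPath_iff_mul_wordProd_eq (by rw [card_invSet_one, card_invSet_revPerm, zero_add]),
    one_mul]

end Words

section Ballot

variable {m : ℕ}

/-- The number of occurrences of the letter `i` among the first `t` letters of `v`. -/
def letterCount {k : ℕ} (v : Fin k → Fin m) (t : ℕ) (i : Fin m) : ℕ :=
  (Finset.univ.filter fun s : Fin k => (s : ℕ) < t ∧ v s = i).card

theorem letterCount_zero {k : ℕ} (v : Fin k → Fin m) (i : Fin m) : letterCount v 0 i = 0 := by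
  simp [letterCount]

theorem letterCount_succ {k : ℕ} (v : Fin (k + 1) → Fin m) (t : ℕ) (i : Fin m) :
    letterCount v (t + 1) i = (if v 0 = i then 1 else 0) + letterCount (Fin.tail v) t i := by
  rw [letterCount, Fin.card_filter_univ_succ']
  simp only [letterCount, Fin.val_zero, Nat.zero_lt_succ, true_and, Fin.val_succ,
    Nat.succ_lt_succ_iff, Fin.tail]
  rfl

theorem add_single_add_letterCount {k : ℕ} (v : Fin (k + 1) → Fin m) (t : ℕ) (α : Fin m → ℤ) :
    (fun i => (α + Pi.single (v 0) 1 : Fin m → ℤ) i + (letterCount (Fin.tail v) t i : ℤ)) =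
      fun i => α i + (letterCount v (t + 1) i : ℤ) := by
  funext i
  rw [letterCount_succ, Pi.add_apply, Pi.single_apply]
  push_cast
  simp only [eq_comm (a := i), add_assoc]

theorem isPath_add_single_iff (P : (Fin m → ℤ) → Prop) {k : ℕ} (v : Fin k → Fin m)
    {α : Fin m → ℤ} (hα : StrictMono α) :
    IsPath (fun α i => StrictMono (α + Pi.single i 1)) (fun α i => α + Pi.single i 1) P k α v ↔
      (∀ t ≤ k, StrictMono fun i => α i + (letterCount v t i : ℤ)) ∧
        P fun i => α i + (letterCount v k i : ℤ) := by
  induction k generalizing α with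
  | zero =>
    simp only [IsPath, Nat.le_zero, forall_eq, letterCount_zero, Nat.cast_zero, add_zero]
    exact ⟨fun h => ⟨hα, h⟩, fun h => h.2⟩
  | succ k ih =>
    rw [IsPath]
    constructor
    · rintro ⟨h1, h2⟩
      rw [ih _ h1] at h2
      simp only [add_single_add_letterCount] at h2
      refine ⟨fun t ht => ?_, h2.2⟩
      cases t with
      | zero => simpa [letterCount_zero] using hα
      | succ t => exact h2.1 t (by omega)
    · rintro ⟨h1, h2⟩
      have h3 : StrictMono (α + Pi.single (v 0) 1) := by
        have := h1 1 (by omega)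
        rw [← add_single_add_letterCount v 0] at this
        simpa only [letterCount_zero, Nat.cast_zero, add_zero] using this
      refine ⟨h3, (ih _ h3).2 ?_⟩
      simp only [add_single_add_letterCount]
      exact ⟨fun t ht => h1 _ (by omega), h2⟩

/-- The words whose prefixes contain each letter at least as often as any smaller letter, and
which contain each letter `i` exactly `i + 1` times. -/
def IsBallot {k : ℕ} (v : Fin k → Fin m) : Prop :=
  (∀ t ≤ k, Monotone (letterCount v t)) ∧ ∀ i, letterCount v k i = i + 1

theorem strictMono_val_add_iff (c : Fin m → ℕ) :
    (StrictMono fun i : Fin m => ((i : ℕ) : ℤ) + (c i : ℤ)) ↔ Monotone c := by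
  cases m with
  | zero => exact ⟨fun _ i => i.elim0, fun _ i => i.elim0⟩
  | succ p =>
    rw [Fin.strictMono_iff_lt_succ, Fin.monotone_iff_le_succ]
    refine forall_congr' fun i => ?_
    simp only [Fin.val_castSucc, Fin.val_succ]
    push_cast
    omega

theorem isPath_val_iff_isBallot {k : ℕ} (v : Fin k → Fin m) :
    IsPath (fun α i => StrictMono (α + Pi.single i 1)) (fun α i => α + Pi.single i 1)
      (fun α : Fin m → ℤ => ∀ i, α i = 2 * ((i : ℕ) : ℤ) + 1) k (fun i => ((i : ℕ) : ℤ)) v ↔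
        IsBallot v := by
  rw [isPath_add_single_iff _ _ (fun i j h => by simpa using h), IsBallot]
  simp only [strictMono_val_add_iff]
  refine and_congr_right fun _ => forall_congr' fun i => ?_
  omega

theorem NilElemModel.revCoeff_pow_mul_shiftDet {p : ℕ} {R : Type} [CommRing R]
    {f : R →+* Module.End ℤ WordFun} {e : ℤ → R} (h : NilElemModel ascentOp (p + 1) f e) (k : ℕ)
    {α : Fin (p + 1) → ℤ} (hα : StrictMono α) (hα0 : ∀ i, 0 ≤ α i) :
    revCoeff (p + 1) (f (e 1 ^ k * shiftDet e α)) =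
      Nat.card {v : Fin k → Fin (p + 1) // IsPath (fun α i => StrictMono (α + Pi.single i 1))
        (fun α i => α + Pi.single i 1)
        (fun α : Fin (p + 1) → ℤ => ∀ i, α i = 2 * ((i : ℕ) : ℤ) + 1) k α v} := by
  classical
  induction k generalizing α with
  | zero =>
    rw [card_isPath_zero, pow_zero, one_mul, revCoeff_shiftDet h hα hα0]
    simp only [Nat.cast_ite, Nat.cast_one, Nat.cast_zero]
  | succ k ih =>
    rw [card_isPath_succ, pow_succ, mul_assoc,
      ← sum_shiftDet_add_single h.of_neg h.zero h.isRecurrent hα0, Finset.mul_sum, map_sum,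
      map_sum, Nat.cast_sum]
    refine Finset.sum_congr rfl fun i _ => ?_
    split_ifs with hi
    · refine ih hi fun j => add_nonneg (hα0 j) ?_
      rw [Pi.single_apply]
      split_ifs <;> norm_num
    · have : ¬ Function.Injective (α + Pi.single i 1) := by
        refine fun hinj => hi (Monotone.strictMono_of_injective (fun a b hab => ?_) hinj)
        rcases hab.eq_or_lt with rfl | hab
        · exact le_rfl
        · have := hα hab
          simp only [Pi.add_apply, Pi.single_apply]
          split_ifs <;> omega
      obtain ⟨a, b, hab, hne⟩ : ∃ a b, (α + Pi.single i 1 : Fin (p + 1) → ℤ) a =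
          (α + Pi.single i 1 : Fin (p + 1) → ℤ) b ∧ a ≠ b := by
        simpa [Function.Injective] using this
      rw [shiftDet_eq_zero_of_eq e hne hab, mul_zero, map_zero, map_zero, Nat.cast_zero]

theorem card_wordProd_eq_card_isBallot (p : ℕ) :
    Nat.card {v : Fin ((p + 1 + 1) * (p + 1) / 2) → Fin (p + 1) // wordProd v = Fin.revPerm} =
      Nat.card {v : Fin ((p + 1 + 1) * (p + 1) / 2) → Fin (p + 1) // IsBallot v} := by
  obtain ⟨R, _, f, e, h⟩ := isNilCoxeter_ascentOp.exists_nilElemModel (p + 1)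
  have h1 := h.revCoeff_pow_mul_shiftDet ((p + 1 + 1) * (p + 1) / 2)
    (α := fun i => ((i : ℕ) : ℤ)) (fun i j h => by simpa using h) (fun i => by positivity)
  rw [shiftDet_id h.of_neg h.zero, mul_one, map_pow, h.map_eq, revCoeff_nilElem_one_pow] at h1
  simp only [isPath_val_iff_isBallot] at h1
  exact_mod_cast h1

theorem letterCount_eq_card {k r : ℕ} {v : Fin k → Fin m} {i : Fin m} {E : Fin r → Fin k}
    (hE : Function.Injective E) (hr : ∀ s, v s = i ↔ s ∈ Set.range E) (t : ℕ) :
    letterCount v t i = (Finset.univ.filter fun c => (E c : ℕ) < t).card := by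
  rw [← Finset.card_map ⟨E, hE⟩, letterCount]
  congr 1
  ext s
  simp only [Finset.mem_filter, Finset.mem_univ, true_and, Finset.mem_map,
    Function.Embedding.coeFn_mk, hr, Set.mem_range]
  constructor
  · rintro ⟨hs, c, rfl⟩
    exact ⟨c, hs, rfl⟩
  · rintro ⟨c, hs, rfl⟩
    exact ⟨hs, c, rfl⟩

end Ballot

section Staircase

variable {m : ℕ}

/-- The `k`-th cell of the row of length `i + 1`. -/
def staircaseCell (p : Σ i : Fin m, Fin (i + 1)) : StaircaseCell (m + 1) :=
  ⟨(m - 1 - p.1, p.2), by have := p.1.isLt; have := p.2.isLt; simp only; omega⟩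

theorem staircaseCell_bijective : Function.Bijective (staircaseCell (m := m)) := by
  constructor
  · rintro ⟨⟨i, hi⟩, ⟨k, hk⟩⟩ ⟨⟨j, hj⟩, ⟨l, hl⟩⟩ h
    have h' := congrArg Subtype.val h
    simp only [staircaseCell, Prod.mk.injEq] at h'
    obtain rfl : i = j := by omega
    obtain rfl : k = l := h'.2
    rfl
  · rintro ⟨⟨a, b⟩, h⟩
    simp only [Nat.add_sub_cancel] at h
    refine ⟨⟨⟨m - 1 - a, by omega⟩, ⟨b, by simp only; omega⟩⟩, Subtype.ext ?_⟩
    simp only [staircaseCell, Prod.mk.injEq, and_true]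
    omega

/-- The cells of the staircase, indexed by the length of the row and the column. -/
noncomputable def staircaseCellEquiv (m : ℕ) : (Σ i : Fin m, Fin (i + 1)) ≃ StaircaseCell (m + 1) :=
  Equiv.ofBijective staircaseCell staircaseCell_bijective

theorem isStaircaseSYT_iff (T : StaircaseCell (m + 1) → Fin ((m + 1) * m / 2)) :
    IsStaircaseSYT (m + 1) T ↔ Function.Bijective T ∧
      (∀ i : Fin m, StrictMono fun k : Fin (i + 1) => T (staircaseCell ⟨i, k⟩)) ∧
      ∀ i j : Fin m, ∀ (hij : i < j) (k : Fin (i + 1)),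
        T (staircaseCell ⟨j, k.castLE (by have : (i : ℕ) < j := hij; omega)⟩) <
          T (staircaseCell ⟨i, k⟩) := by
  refine and_congr_right fun _ => and_congr ⟨fun h i k l hkl => h _ _ rfl hkl, fun h c d => ?_⟩
    ⟨fun h i j hij k => h _ _ rfl ?_, fun h c d => ?_⟩
  · obtain ⟨⟨i, k⟩, rfl⟩ := staircaseCell_bijective.2 c
    obtain ⟨⟨j, l⟩, rfl⟩ := staircaseCell_bijective.2 d
    intro h1 h2
    simp only [staircaseCell] at h1 h2
    obtain rfl : i = j := Fin.ext (by omega)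
    exact h i h2
  · have : (i : ℕ) < j := hij
    have := j.isLt
    simp only [staircaseCell]
    omega
  · obtain ⟨⟨i, k⟩, rfl⟩ := staircaseCell_bijective.2 c
    obtain ⟨⟨j, l⟩, rfl⟩ := staircaseCell_bijective.2 d
    intro h1 h2
    simp only [staircaseCell] at h1 h2
    have hij : j < i := by rw [Fin.lt_def]; omega
    have hle : (j : ℕ) + 1 ≤ i + 1 := by have : (j : ℕ) < i := hij; omega
    obtain rfl : k = l.castLE hle := Fin.ext h1
    exact h j i hij l

/-- The word recording the rows of the entries of a bijective filling of the staircase. -/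
noncomputable def rowWord {k : ℕ} (T : StaircaseCell (m + 1) → Fin k) (hT : Function.Bijective T)
    (t : Fin k) : Fin m :=
  ((staircaseCellEquiv m).symm ((Equiv.ofBijective T hT).symm t)).1

theorem rowWord_eq_iff {k : ℕ} {T : StaircaseCell (m + 1) → Fin k} (hT : Function.Bijective T)
    (t : Fin k) (i : Fin m) :
    rowWord T hT t = i ↔ t ∈ Set.range fun c : Fin (i + 1) => T (staircaseCell ⟨i, c⟩) := by
  obtain ⟨c, rfl⟩ := hT.2 t
  obtain ⟨⟨j, k⟩, rfl⟩ := staircaseCell_bijective.2 c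
  have h : rowWord T hT (T (staircaseCell ⟨j, k⟩)) = j := by
    have h1 : (Equiv.ofBijective T hT).symm (T (staircaseCell ⟨j, k⟩)) =
        staircaseCellEquiv m ⟨j, k⟩ := Equiv.ofBijective_symm_apply_apply T hT _
    rw [rowWord, h1, Equiv.symm_apply_apply]
  rw [h]
  constructor
  · rintro rfl
    exact ⟨k, rfl⟩
  · rintro ⟨l, hl⟩
    have := staircaseCell_bijective.1 (hT.1 hl)
    exact (congrArg Sigma.fst this).symm

theorem isBallot_rowWord {T : StaircaseCell (m + 1) → Fin ((m + 1) * m / 2)}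
    (h : IsStaircaseSYT (m + 1) T) : IsBallot (rowWord T h.1) := by
  obtain ⟨hb, hrow, hcol⟩ := (isStaircaseSYT_iff T).1 h
  have hc (t : ℕ) (i : Fin m) : letterCount (rowWord T h.1) t i = _ :=
    letterCount_eq_card (hrow i).injective (fun s => rowWord_eq_iff h.1 s i) t
  refine ⟨fun t _ i j hij => ?_, fun i => ?_⟩
  · rcases hij.eq_or_lt with rfl | hij
    · exact le_rfl
    · have hle : (i : ℕ) + 1 ≤ j + 1 := by have : (i : ℕ) < j := hij; omega
      rw [hc, hc]
      refine Finset.card_le_card_of_injOn (Fin.castLE hle) (fun k hk => ?_)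
        (Fin.castLE_injective hle).injOn
      simp only [Finset.coe_filter, Finset.mem_univ, true_and, Set.mem_ofPred_eq] at hk ⊢
      exact lt_trans (hcol i j hij k) hk
  · rw [hc, Finset.filter_true_of_mem fun c _ => Fin.isLt _]
    simp

theorem rowWord_injective {T T' : StaircaseCell (m + 1) → Fin ((m + 1) * m / 2)}
    (h : IsStaircaseSYT (m + 1) T) (h' : IsStaircaseSYT (m + 1) T')
    (heq : rowWord T h.1 = rowWord T' h'.1) : T = T' := by
  funext c
  obtain ⟨⟨i, k⟩, rfl⟩ := staircaseCell_bijective.2 c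
  have := (((isStaircaseSYT_iff T).1 h).2.1 i).range_inj (((isStaircaseSYT_iff T').1 h').2.1 i)
  refine congrFun (this.1 ?_) k
  ext s
  rw [← rowWord_eq_iff h.1, ← rowWord_eq_iff h'.1, heq]

theorem exists_rowWord_eq {v : Fin ((m + 1) * m / 2) → Fin m} (hv : IsBallot v) :
    ∃ (T : _) (h : IsStaircaseSYT (m + 1) T), rowWord T h.1 = v := by
  have hcard (i : Fin m) : (Finset.univ.filter fun t => v t = i).card = i + 1 := by
    rw [← hv.2 i, letterCount]
    simp
  obtain ⟨E, hE⟩ : ∃ E : ∀ i : Fin m, Fin (i + 1) ↪o Fin ((m + 1) * m / 2),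
      ∀ i s, v s = i ↔ s ∈ Set.range (E i) :=
    ⟨fun i => (Finset.univ.filter fun t => v t = i).orderEmbOfFin (hcard i), fun i s => by simp⟩
  have hvE (i : Fin m) (k) : v (E i k) = i := (hE i _).2 ⟨k, rfl⟩
  obtain ⟨T, hT⟩ : ∃ T : StaircaseCell (m + 1) → Fin ((m + 1) * m / 2),
      ∀ i k, T (staircaseCell ⟨i, k⟩) = E i k := by
    refine ⟨(fun p => E p.1 p.2) ∘ (staircaseCellEquiv m).symm, fun i k => ?_⟩
    have : (staircaseCellEquiv m).symm (staircaseCell ⟨i, k⟩) = ⟨i, k⟩ :=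
      (staircaseCellEquiv m).symm_apply_apply _
    rw [Function.comp_apply, this]
  have hSYT : IsStaircaseSYT (m + 1) T := by
    rw [isStaircaseSYT_iff]
    refine ⟨⟨fun c d hcd => ?_, fun t => ?_⟩, fun i k l hkl => ?_, fun i j hij k => ?_⟩
    · obtain ⟨⟨i, k⟩, rfl⟩ := staircaseCell_bijective.2 c
      obtain ⟨⟨j, l⟩, rfl⟩ := staircaseCell_bijective.2 d
      rw [hT, hT] at hcd
      obtain rfl : i = j := by rw [← hvE i k, hcd, hvE]
      rw [(E i).injective hcd]
    · obtain ⟨k, hk⟩ := (hE (v t) t).1 rfl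
      exact ⟨staircaseCell ⟨v t, k⟩, (hT _ _).trans hk⟩
    · simp only [hT]
      exact (E i).strictMono hkl
    · have hlt : (i : ℕ) < j := hij
      rw [hT, hT]
      by_contra hnot
      set k' : Fin (j + 1) := k.castLE (by omega) with hk'
      have hne : E i k ≠ E j k' := fun h => hij.ne (by rw [← hvE i k, h, hvE])
      have hlt' : E i k < E j k' := lt_of_le_of_ne (not_lt.1 hnot) hne
      have hmono := hv.1 (E i k + 1) (E i k).isLt hij.le
      rw [letterCount_eq_card (E i).injective (hE i), letterCount_eq_card (E j).injective (hE j)]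
        at hmono
      have h1 : (Finset.Iic k).card ≤
          (Finset.univ.filter fun c => (E i c : ℕ) < E i k + 1).card := by
        refine Finset.card_le_card fun c hc => ?_
        simp only [Finset.mem_filter, Finset.mem_univ, true_and]
        exact Nat.lt_succ_of_le ((E i).monotone (Finset.mem_Iic.1 hc))
      have h2 : (Finset.univ.filter fun c => (E j c : ℕ) < E i k + 1).card ≤
          (Finset.Iio k').card := by
        refine Finset.card_le_card fun c hc => ?_
        simp only [Finset.mem_filter, Finset.mem_univ, true_and] at hc
        exact Finset.mem_Iio.2 ((E j).lt_iff_lt.1 (lt_of_le_of_lt (Nat.le_of_lt_succ hc) hlt'))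
      rw [Fin.card_Iic] at h1
      rw [Fin.card_Iio] at h2
      have : (k' : ℕ) = k := rfl
      omega
  refine ⟨T, hSYT, funext fun t => ?_⟩
  rw [rowWord_eq_iff]
  simp only [hT]
  exact (hE _ _).1 rfl

theorem card_isStaircaseSYT_eq_card_isBallot (m : ℕ) :
    Nat.card {T : StaircaseCell (m + 1) → Fin ((m + 1) * m / 2) // IsStaircaseSYT (m + 1) T} =
      Nat.card {v : Fin ((m + 1) * m / 2) → Fin m // IsBallot v} := by
  refine Nat.card_congr (Equiv.ofBijective
    (fun T => ⟨rowWord T.1 T.2.1, isBallot_rowWord T.2⟩) ⟨fun T T' h => ?_, fun v => ?_⟩)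
  · exact Subtype.ext (rowWord_injective T.2 T'.2 (congrArg Subtype.val h))
  · obtain ⟨T, h, hT⟩ := exists_rowWord_eq v.2
    exact ⟨⟨T, h⟩, Subtype.ext hT⟩

end Staircase

theorem reduced_words_eq_staircase_SYT (n : ℕ) (hn : 2 ≤ n) :
    Nat.card {w : Fin (n * (n - 1) / 2) → Fin (n - 1) //
        (List.ofFn fun j => adjTransposition (w j)).prod = (Fin.revPerm : Equiv.Perm (Fin n))} =
      Nat.card {T : StaircaseCell n → Fin (n * (n - 1) / 2) // IsStaircaseSYT n T} := by
  obtain ⟨p, rfl⟩ : ∃ p, n = p + 1 + 1 := ⟨n - 2, by omega⟩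
  exact (card_wordProd_eq_card_isBallot p).trans (card_isStaircaseSYT_eq_card_isBallot (p + 1)).symm
end
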